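/- Assume 1/2 ≤ d·θ² ≤ 1. For any 0 < ε < 1 and α > 1 there exist constants C = C(π, ε, α) and N1 = N1(π, ε, α) such that for all n ≥ N1: P(|π1·Z1/(π1·Z1 + π2·Z2) − π1| > ε) ≤ C·x_n^α. -/

import Mathlib

open Finset Filter

namespace AsymIsing

/-- Level-`k` vertices of the rooted `d`-ary tree: paths of length `k` from the root. -/
abbrev Vert (d k : ℕ) : Type := Fin k → Fin d

/-- A spin configuration on levels `0, …, n` of the `d`-ary tree. -/
abbrev Conf (d n : ℕ) : Type := ∀ k : Fin (n + 1), Vert d k → Fin 2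

/-- A spin configuration on level `n` only. -/
abbrev LConf (d n : ℕ) : Type := Vert d n → Fin 2

/-- The transition matrix of the asymmetric binary channel; the paper's state `1`
corresponds to the index `0` and the state `2` to the index `1`. -/
noncomputable def Mmat (θ Δ : ℝ) : Fin 2 → Fin 2 → ℝ := fun i j =>
  if i = 0 then (if j = 0 then (1 + θ - Δ) / 2 else (1 - θ + Δ) / 2)
  else (if j = 0 then (1 - θ - Δ) / 2 else (1 + θ + Δ) / 2)

/-- The stationary distribution `π = (π₁, π₂)` of the channel. -/
noncomputable def pst (θ Δ : ℝ) : Fin 2 → ℝ := fun i =>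
  if i = 0 then 1 / 2 - Δ / (2 * (1 - θ)) else 1 / 2 + Δ / (2 * (1 - θ))

/-- The root spin of a configuration. -/
def root {d n : ℕ} (σ : Conf d n) : Fin 2 := σ ⟨0, n.succ_pos⟩ (fun i => i.elim0)

/-- The restriction of a configuration to the last (`n`-th) level. -/
def top {d n : ℕ} (σ : Conf d n) : LConf d n := σ (Fin.last n)

/-- The probability of a full configuration on levels `0, …, n` under the broadcast
process: the root is drawn from `π` and spins propagate along edges via `M`. -/
noncomputable def confProb (d : ℕ) (θ Δ : ℝ) (n : ℕ) (σ : Conf d n) : ℝ :=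
  pst θ Δ (root σ) *
    ∏ k : Fin n, ∏ v : Vert d (k + 1),
      Mmat θ Δ (σ k.castSucc (v ∘ Fin.castSucc)) (σ k.succ v)

/-- `P(σ(n) = A)`: the marginal law of the level-`n` spins. -/
noncomputable def levelProb (d : ℕ) (θ Δ : ℝ) (n : ℕ) (A : LConf d n) : ℝ :=
  ∑ σ : Conf d n, if top σ = A then confProb d θ Δ n σ else 0

/-- `P(σ_ρ = i, σ(n) = A)`. -/
noncomputable def jointProb (d : ℕ) (θ Δ : ℝ) (n : ℕ) (i : Fin 2) (A : LConf d n) : ℝ :=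
  ∑ σ : Conf d n, if root σ = i ∧ top σ = A then confProb d θ Δ n σ else 0

/-- The posterior `f_n(i, A) = P(σ_ρ = i ∣ σ(n) = A)`. -/
noncomputable def post (d : ℕ) (θ Δ : ℝ) (n : ℕ) (i : Fin 2) (A : LConf d n) : ℝ :=
  jointProb d θ Δ n i A / levelProb d θ Δ n A

/-- The law of `σ^i(n)`, i.e. `P(σ(n) = A ∣ σ_ρ = i)`. -/
noncomputable def condLevel (d : ℕ) (θ Δ : ℝ) (n : ℕ) (i : Fin 2) (A : LConf d n) : ℝ :=
  jointProb d θ Δ n i A / pst θ Δ i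

/-- The total variation distance between `σ^1(n)` and `σ^2(n)`. -/
noncomputable def tvDist (d : ℕ) (θ Δ : ℝ) (n : ℕ) : ℝ :=
  (1 / 2) * ∑ A : LConf d n, |condLevel d θ Δ n 0 A - condLevel d θ Δ n 1 A|

/-- The reconstruction problem is solvable if `limsup_n d_TV(σ^1(n), σ^2(n)) > 0`. -/
def solvable (d : ℕ) (θ Δ : ℝ) : Prop :=
  0 < Filter.limsup (fun n => tvDist d θ Δ n) Filter.atTop

/-- Non-reconstruction: `limsup_n d_TV(σ^1(n), σ^2(n)) = 0`. -/
def nonReconstruction (d : ℕ) (θ Δ : ℝ) : Prop :=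
  Filter.limsup (fun n => tvDist d θ Δ n) Filter.atTop = 0

/-- Expectation of a function of the level-`n` configuration, conditioned on `σ_ρ = 1`. -/
noncomputable def expect1 (d : ℕ) (θ Δ : ℝ) (n : ℕ) (g : LConf d n → ℝ) : ℝ :=
  ∑ A : LConf d n, condLevel d θ Δ n 0 A * g A

/-- `x_n = E f_n(1, σ^1(n)) − π₁`. -/
noncomputable def xseq (d : ℕ) (θ Δ : ℝ) (n : ℕ) : ℝ :=
  expect1 d θ Δ n (fun A => post d θ Δ n 0 A) - pst θ Δ 0

/-- `z_n = E (f_n(1, σ^1(n)) − π₁)²`. -/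
noncomputable def zseq (d : ℕ) (θ Δ : ℝ) (n : ℕ) : ℝ :=
  expect1 d θ Δ n (fun A => (post d θ Δ n 0 A - pst θ Δ 0) ^ 2)

/-- The restriction of a level-`(n+1)` configuration to the subtree of the `j`-th
child of the root (paths starting with `j`). -/
def restrictChild {d n : ℕ} (j : Fin d) (A : LConf d (n + 1)) : LConf d n :=
  fun w => A (Fin.cons j w)

/-- `Y_j = f_n(1, σ_j(n+1))`, as a function of the level-`(n+1)` configuration. -/
noncomputable def Yfun (d : ℕ) (θ Δ : ℝ) (n : ℕ) (j : Fin d) (A : LConf d (n + 1)) : ℝ :=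
  post d θ Δ n 0 (restrictChild j A)

/-- `Z₁ = ∏_j (1 + (θ/π₁)(Y_j − π₁))`, as a function of the level-`(n+1)` configuration. -/
noncomputable def Z1fun (d : ℕ) (θ Δ : ℝ) (n : ℕ) (A : LConf d (n + 1)) : ℝ :=
  ∏ j : Fin d, (1 + (θ / pst θ Δ 0) * (Yfun d θ Δ n j A - pst θ Δ 0))

/-- `Z₂ = ∏_j (1 − (θ/π₂)(Y_j − π₁))`, as a function of the level-`(n+1)` configuration. -/
noncomputable def Z2fun (d : ℕ) (θ Δ : ℝ) (n : ℕ) (A : LConf d (n + 1)) : ℝ :=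
  ∏ j : Fin d, (1 - (θ / pst θ Δ 1) * (Yfun d θ Δ n j A - pst θ Δ 0))

/-- The value of `Δ` making `π = (π₁, π₂)` the stationary distribution of the channel
with second eigenvalue `θ`, namely `Δ = (1 − θ)(π₂ − π₁)`. -/
noncomputable def Dlt (θ π1 π2 : ℝ) : ℝ := (1 - θ) * (π2 - π1)

/-- The Gaussian-approximation function
`f(s) = E[π₁ e^{sμ₁+√s W₁} / (π₁ e^{sμ₁+√s W₁} + π₂ e^{sμ₂+√s W₂})] − π₁`,
where `μ₁ = 1/(2π₁)`, `μ₂ = −(1+π₂)/(2π₂²)`, `W₁ ∼ N(0, 1/π₁)` (realized as `w/√π₁`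
for `w` standard Gaussian) and `W₂ = −(π₁/π₂)·W₁`. -/
noncomputable def gfun (π1 π2 : ℝ) (s : ℝ) : ℝ :=
  (∫ w : ℝ,
      (π1 * Real.exp (s * (1 / (2 * π1)) + Real.sqrt s * (w / Real.sqrt π1))) /
        (π1 * Real.exp (s * (1 / (2 * π1)) + Real.sqrt s * (w / Real.sqrt π1)) +
          π2 * Real.exp (s * (-(1 + π2) / (2 * π2 ^ 2)) +
            Real.sqrt s * (-(π1 / π2) * (w / Real.sqrt π1))))
    ∂(ProbabilityTheory.gaussianReal 0 1)) - π1

/-- `P(|π₁Z₁/(π₁Z₁ + π₂Z₂) − π₁| > ε)` under the conditioning `σ_ρ = 1`. -/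
noncomputable def probBad (d : ℕ) (θ Δ : ℝ) (n : ℕ) (ε : ℝ) : ℝ :=
  ∑ A : LConf d (n + 1),
    if ε < |pst θ Δ 0 * Z1fun d θ Δ n A /
        (pst θ Δ 0 * Z1fun d θ Δ n A + pst θ Δ 1 * Z2fun d θ Δ n A) - pst θ Δ 0|
    then condLevel d θ Δ (n + 1) 0 A else 0

/-- The product of the transition probabilities along all edges of a configuration. -/
noncomputable def edgeWeight (d : ℕ) (θ Δ : ℝ) (n : ℕ) (σ : Conf d n) : ℝ :=
  ∏ k : Fin n, ∏ v : Vert d (k + 1),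
    Mmat θ Δ (σ k.castSucc (v ∘ Fin.castSucc)) (σ k.succ v)

/-- The likelihood of the level-`n` configuration `A` given that the root has spin `i`. -/
noncomputable def lik (d : ℕ) (θ Δ : ℝ) (n : ℕ) (i : Fin 2) (A : LConf d n) : ℝ :=
  ∑ σ : Conf d n, if root σ = i ∧ top σ = A then edgeWeight d θ Δ n σ else 0

/-- The restriction of a configuration to the subtree of the `j`-th child of the root. -/
def childConf {d n : ℕ} (σ : Conf d (n + 1)) (j : Fin d) : Conf d n :=
  fun k w => σ k.succ (Fin.cons j w)

/-- A configuration is the same as a root spin together with a configuration on the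
subtree of each child of the root. -/
def confEquiv (d n : ℕ) : Conf d (n + 1) ≃ Fin 2 × (Fin d → Conf d n) where
  toFun σ := (root σ, childConf σ)
  invFun p := fun k => Fin.cases (motive := fun k : Fin (n + 2) => Vert d k → Fin 2)
    (fun _ => p.1) (fun k (v : Vert d (k + 1)) => p.2 (v 0) k (Fin.tail v)) k
  left_inv σ := by
    funext k
    refine Fin.cases ?_ (fun k => ?_) k
    · funext v
      exact congrArg (σ 0) (funext fun i => i.elim0)
    · funext v
      exact congrArg (σ k.succ) (Fin.cons_self_tail (α := fun _ => Fin d) v)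
  right_inv p := by
    rcases p with ⟨i, τ⟩
    rfl

/-- A configuration on level `n + 1` is a family of level-`n` configurations, one on the
subtree of each child of the root. -/
def levelEquiv (d n : ℕ) : LConf d (n + 1) ≃ (Fin d → LConf d n) where
  toFun A := fun j => restrictChild j A
  invFun B := fun v => B (v 0) (Fin.tail v)
  left_inv A := by
    funext v
    exact congrArg A (Fin.cons_self_tail (α := fun _ => Fin d) v)
  right_inv B := rfl

lemma edgeWeight_succ (d : ℕ) (θ Δ : ℝ) (n : ℕ) (σ : Conf d (n + 1)) :
    edgeWeight d θ Δ (n + 1) σ =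
      ∏ j, (Mmat θ Δ (root σ) (root (childConf σ j)) * edgeWeight d θ Δ n (childConf σ j)) := by
  have split : ∀ (m : ℕ) (F : Vert d (m + 1) → ℝ),
      ∏ v, F v = ∏ j : Fin d, ∏ w : Vert d m, F (Fin.cons j w) := by
    intro m F
    rw [← Fintype.prod_prod_type']
    exact (Fintype.prod_equiv (Fin.consEquiv fun _ : Fin (m + 1) => Fin d) _ _
      fun _ => rfl).symm
  rw [edgeWeight, Fin.prod_univ_succ, Finset.prod_mul_distrib]
  congr 1
  · rw [split]
    refine Finset.prod_congr rfl fun j _ => ?_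
    refine (Fintype.prod_unique (ι := Vert d 0) _).trans ?_
    have h1 : ∀ u : Vert d 0, σ 0 u = root σ := fun u =>
      congrArg (σ 0) (funext fun i => i.elim0)
    have h2 : (default : Vert d 0) = fun i => i.elim0 := funext fun i => i.elim0
    exact congrArg₂ (Mmat θ Δ) (h1 _)
      (congrArg (fun u : Vert d 0 => σ (Fin.succ 0) (Fin.cons j u)) h2)
  · simp only [edgeWeight]
    rw [Finset.prod_comm]
    refine Finset.prod_congr rfl fun k _ => ?_
    refine (split _ _).trans ?_
    refine Finset.prod_congr rfl fun j _ => Finset.prod_congr rfl fun w _ => ?_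
    have h : ((Fin.cons j w : Vert d (k + 1 + 1)) ∘ Fin.castSucc)
        = (Fin.cons j (w ∘ Fin.castSucc) : Vert d (k + 1)) := by
      funext i
      refine Fin.cases rfl (fun i => ?_) i
      rfl
    exact congrArg₂ (Mmat θ Δ) (congrArg (σ k.castSucc.succ) h) rfl

lemma lik_zero (d : ℕ) (θ Δ : ℝ) (i : Fin 2) (A : LConf d 0) :
    lik d θ Δ 0 i A = if A (fun i => i.elim0) = i then 1 else 0 := by
  have key : ∀ σ : Conf d 0, (root σ = i ∧ top σ = A) ↔
      σ = (fun k v => A (fun i => i.elim0)) ∧ A (fun i => i.elim0) = i := by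
    intro σ
    have hr : root σ = top σ (fun i => i.elim0) := rfl
    constructor
    · rintro ⟨h1, h2⟩
      refine ⟨?_, by rw [← h1, hr, h2]⟩
      funext k v
      have hk : k = 0 := Fin.fin_one_eq_zero k
      subst hk
      rw [← h2]
      exact congrArg (σ 0) (funext fun i => i.elim0)
    · rintro ⟨h1, h2⟩
      subst h1
      refine ⟨h2, ?_⟩
      funext v
      exact congrArg A (funext fun i => i.elim0)
  simp only [lik, key]
  by_cases h : A (fun i => i.elim0) = i
  · simp [h, edgeWeight]
  · simp [h]

lemma lik_succ (d : ℕ) (θ Δ : ℝ) (n : ℕ) (i : Fin 2) (A : LConf d (n + 1)) :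
    lik d θ Δ (n + 1) i A =
      ∏ j : Fin d, ∑ s, Mmat θ Δ i s * lik d θ Δ n s (restrictChild j A) := by
  have h1 : ∀ j : Fin d, ∑ s, Mmat θ Δ i s * lik d θ Δ n s (restrictChild j A)
      = ∑ τ : Conf d n, if top τ = restrictChild j A then
          Mmat θ Δ i (root τ) * edgeWeight d θ Δ n τ else 0 := by
    intro j
    simp only [lik, Finset.mul_sum]
    rw [Finset.sum_comm]
    refine Finset.sum_congr rfl fun τ _ => ?_
    by_cases h : top τ = restrictChild j A <;> simp [h]
  have h2 : ∀ σ : Conf d (n + 1), top σ = A ↔ ∀ j, top (childConf σ j) = restrictChild j A :=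
    fun σ => (levelEquiv d n).injective.eq_iff.symm.trans funext_iff
  simp only [h1]
  rw [Finset.prod_univ_sum, Fintype.piFinset_univ, lik, Fintype.sum_equiv (confEquiv d n) _
    (fun p => if p.1 = i ∧ (∀ j, top (p.2 j) = restrictChild j A) then
      ∏ j, (Mmat θ Δ p.1 (root (p.2 j)) * edgeWeight d θ Δ n (p.2 j)) else 0)
    (fun σ => by simp only [edgeWeight_succ, h2]; rfl), Fintype.sum_prod_type,
    Finset.sum_comm]
  refine Finset.sum_congr rfl fun τ _ => ?_
  rw [Finset.prod_ite_zero]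
  simp [ite_and]

lemma jointProb_eq (d : ℕ) (θ Δ : ℝ) (n : ℕ) (i : Fin 2) (A : LConf d n) :
    jointProb d θ Δ n i A = pst θ Δ i * lik d θ Δ n i A := by
  simp only [jointProb, lik, Finset.mul_sum]
  refine Finset.sum_congr rfl fun σ _ => ?_
  split_ifs with h
  · rw [← h.1]; rfl
  · simp

lemma levelProb_eq (d : ℕ) (θ Δ : ℝ) (n : ℕ) (A : LConf d n) :
    levelProb d θ Δ n A = pst θ Δ 0 * lik d θ Δ n 0 A + pst θ Δ 1 * lik d θ Δ n 1 A := by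
  rw [← jointProb_eq, ← jointProb_eq, ← Fin.sum_univ_two (jointProb d θ Δ n · A)]
  simp only [levelProb, jointProb]
  rw [Finset.sum_comm]
  refine Finset.sum_congr rfl fun σ _ => ?_
  by_cases h : top σ = A <;> simp [h]

lemma sum_levelEquiv (d n : ℕ) (F : (Fin d → LConf d n) → ℝ) :
    ∑ A : LConf d (n + 1), F (fun j => restrictChild j A) = ∑ B, F B :=
  Fintype.sum_equiv (levelEquiv d n) _ _ fun _ => rfl

section ProductWeights

variable {Ω : Type*} [Fintype Ω]

lemma sum_prod_mul_prod {d : ℕ} (w : Ω → ℝ) (g : Fin d → Ω → ℝ) :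
    ∑ B : Fin d → Ω, (∏ j, w (B j)) * ∏ j, g j (B j) = ∏ j, ∑ a, w a * g j a := by
  rw [Finset.prod_univ_sum, Fintype.piFinset_univ]
  simp only [Finset.prod_mul_distrib]

lemma sum_prod_weight {d : ℕ} {w : Ω → ℝ} (hw : ∑ a, w a = 1) :
    ∑ B : Fin d → Ω, ∏ j, w (B j) = 1 := by
  simpa [hw] using sum_prod_mul_prod (d := d) w (fun _ _ => 1)

lemma sum_prod_mul_single {d : ℕ} {w : Ω → ℝ} (hw : ∑ a, w a = 1) (g : Ω → ℝ) (j : Fin d) :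
    ∑ B : Fin d → Ω, (∏ j, w (B j)) * g (B j) = ∑ a, w a * g a := by
  have h := sum_prod_mul_prod (d := d) w (fun i a => if i = j then g a else 1)
  simp only [Finset.prod_ite_eq', Finset.mem_univ, if_true] at h
  rw [h, Finset.prod_eq_single j]
  · simp
  · intro i _ hi
    simp [hi, hw]
  · simp

lemma sum_prod_mul_pair {d : ℕ} {w : Ω → ℝ} (hw : ∑ a, w a = 1) (g : Ω → ℝ) {i j : Fin d}
    (hij : i ≠ j) :
    ∑ B : Fin d → Ω, (∏ j, w (B j)) * (g (B i) * g (B j)) = (∑ a, w a * g a) ^ 2 := by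
  have h := sum_prod_mul_prod (d := d) w (fun k a => if k = i ∨ k = j then g a else 1)
  have e : ∀ F : Fin d → ℝ, (∀ k, k ≠ i → k ≠ j → F k = 1) → ∏ k, F k = F i * F j := by
    intro F hF
    rw [← Finset.prod_pair hij]
    refine (Finset.prod_subset (Finset.subset_univ _) fun k _ hk => ?_).symm
    simp only [Finset.mem_insert, Finset.mem_singleton, not_or] at hk
    exact hF k hk.1 hk.2
  rw [e (fun k => ∑ a, w a * if k = i ∨ k = j then g a else 1)] at h
  · simp only [true_or, or_true, if_true] at h
    rw [sq, ← h]
    refine Finset.sum_congr rfl fun B _ => ?_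
    rw [e (fun k => if k = i ∨ k = j then g (B k) else 1)]
    · simp
    · intro k h1 h2
      simp [h1, h2]
  · intro k h1 h2
    simp [h1, h2, hw]

/-- The indicator of a proposition, as a real number. -/
noncomputable def ind (P : Prop) : ℝ := open Classical in if P then 1 else 0

lemma ind_nonneg (P : Prop) : 0 ≤ ind P := by
  unfold ind; split_ifs <;> norm_num

lemma ind_le_one (P : Prop) : ind P ≤ 1 := by
  unfold ind; split_ifs <;> norm_num

lemma ind_of {P : Prop} (h : P) : ind P = 1 := if_pos h

lemma ind_of_not {P : Prop} (h : ¬P) : ind P = 0 := if_neg h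

lemma ind_le_of_imp {P : Prop} {r : ℝ} (hr : 0 ≤ r) (h : P → 1 ≤ r) : ind P ≤ r := by
  by_cases hP : P
  · rw [ind_of hP]; exact h hP
  · rw [ind_of_not hP]; exact hr

/-- A union bound: an event that forces either one coordinate into `E`, or two distinct
coordinates into `F`. -/
lemma sum_prod_mul_ind_le {d : ℕ} {w : Ω → ℝ} (hw0 : ∀ a, 0 ≤ w a) (hw : ∑ a, w a = 1)
    (E F : Ω → Prop) (P : (Fin d → Ω) → Prop)
    (hP : ∀ B, P B → (∃ j, E (B j)) ∨ ∃ i j, i ≠ j ∧ F (B i) ∧ F (B j)) :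
    ∑ B : Fin d → Ω, (∏ j, w (B j)) * ind (P B) ≤
      d * ∑ a, w a * ind (E a) + d ^ 2 * (∑ a, w a * ind (F a)) ^ 2 := by
  have hle : ∀ B : Fin d → Ω, ind (P B) ≤ ∑ j, ind (E (B j)) +
      ∑ i, ∑ j, (if i = j then 0 else ind (F (B i)) * ind (F (B j))) := by
    intro B
    have n1 : ∀ j ∈ Finset.univ, 0 ≤ ind (E (B j)) := fun j _ => ind_nonneg _
    have n2 : ∀ i j, 0 ≤ (if i = j then 0 else ind (F (B i)) * ind (F (B j))) := by
      intro i j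
      split_ifs
      · exact le_rfl
      · exact mul_nonneg (ind_nonneg _) (ind_nonneg _)
    have n3 : ∀ i ∈ Finset.univ,
        0 ≤ ∑ j, (if i = j then 0 else ind (F (B i)) * ind (F (B j))) :=
      fun i _ => Finset.sum_nonneg fun j _ => n2 i j
    refine ind_le_of_imp (add_nonneg (Finset.sum_nonneg n1) (Finset.sum_nonneg n3)) fun h => ?_
    rcases hP B h with ⟨j, hj⟩ | ⟨i, j, hij, hi, hj⟩
    · have := Finset.single_le_sum n1 (Finset.mem_univ j)
      rw [ind_of hj] at this
      linarith [Finset.sum_nonneg n3]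
    · have h1 := Finset.single_le_sum n3 (Finset.mem_univ i)
      have h2 := Finset.single_le_sum (fun j _ => n2 i j) (Finset.mem_univ j)
      have h3 : (if i = j then 0 else ind (F (B i)) * ind (F (B j))) = 1 := by
        rw [if_neg hij, ind_of hi, ind_of hj, mul_one]
      linarith [Finset.sum_nonneg n1]
  calc ∑ B : Fin d → Ω, (∏ j, w (B j)) * ind (P B)
      ≤ ∑ B : Fin d → Ω, (∏ j, w (B j)) * (∑ j, ind (E (B j)) +
          ∑ i, ∑ j, (if i = j then 0 else ind (F (B i)) * ind (F (B j)))) :=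
        Finset.sum_le_sum fun B _ =>
          mul_le_mul_of_nonneg_left (hle B) (Finset.prod_nonneg fun j _ => hw0 _)
    _ = ∑ j : Fin d, ∑ B : Fin d → Ω, (∏ j, w (B j)) * ind (E (B j)) +
          ∑ i : Fin d, ∑ j : Fin d, ∑ B : Fin d → Ω,
            (∏ j, w (B j)) * (if i = j then 0 else ind (F (B i)) * ind (F (B j))) := by
        simp only [mul_add, Finset.sum_add_distrib, Finset.mul_sum]
        rw [Finset.sum_comm]
        congr 1
        rw [Finset.sum_comm]
        exact Finset.sum_congr rfl fun i _ => Finset.sum_comm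
    _ ≤ ∑ j : Fin d, ∑ a, w a * ind (E a) +
          ∑ i : Fin d, ∑ j : Fin d, (∑ a, w a * ind (F a)) ^ 2 := by
        refine add_le_add (le_of_eq ?_) ?_
        · exact Finset.sum_congr rfl fun j _ => sum_prod_mul_single hw (fun a => ind (E a)) j
        · refine Finset.sum_le_sum fun i _ => Finset.sum_le_sum fun j _ => ?_
          by_cases hij : i = j
          · simp [hij, sq_nonneg]
          · simp only [hij, if_false]
            exact (sum_prod_mul_pair hw (fun a => ind (F a)) hij).le
    _ = _ := by
        simp [sq, mul_assoc]

lemma exp_le_one_add_add_sq (u v : ℝ) (h : |u| ≤ v) :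
    Real.exp u ≤ 1 + u + u ^ 2 * Real.exp v := by
  have h1 := Complex.norm_exp_sub_sum_le_norm_mul_exp (u : ℂ) 2
  have h2 : Complex.exp u - ∑ m ∈ Finset.range 2, (u : ℂ) ^ m / m.factorial =
      ((Real.exp u - (1 + u) : ℝ) : ℂ) := by
    simp [Finset.sum_range_succ]
  rw [h2, Complex.norm_real, Complex.norm_real, Real.norm_eq_abs, Real.norm_eq_abs, sq_abs] at h1
  have h3 := mul_le_mul_of_nonneg_left (Real.exp_le_exp.2 h) (sq_nonneg u)
  linarith [le_abs_self (Real.exp u - (1 + u))]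

/-- An exponential Markov bound for sums of independent identically distributed variables
with small mean and variance. -/
lemma chernoff_bound {d : ℕ} {w : Ω → ℝ} (hw0 : ∀ a, 0 ≤ w a) (hw : ∑ a, w a = 1)
    (h : Ω → ℝ) {H c t η α : ℝ} (hH : ∀ a, |h a| ≤ H) (ht : 0 ≤ t) (hη : 0 < η) (hα : 0 < α)
    (hc : 0 ≤ c) (hm : d * ∑ a, w a * h a ≤ c * Real.exp (-t))
    (hv : d * ∑ a, w a * h a ^ 2 ≤ c * Real.exp (-t)) (hHα : H * α / η ≤ 1 / 2) :
    ∑ B : Fin d → Ω, (∏ j, w (B j)) * ind (η ≤ ∑ j, h (B j)) ≤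
      Real.exp (c * (2 * (α / η) + 8 * (α / η) ^ 2)) * Real.exp (-t) ^ α := by
  set l : ℝ := α / η * t with hl
  have hl0 : 0 ≤ l := by positivity
  set m := ∑ a, w a * h a
  set v := ∑ a, w a * h a ^ 2
  have hv0 : 0 ≤ v := Finset.sum_nonneg fun a _ => mul_nonneg (hw0 a) (sq_nonneg _)
  have hmgf : ∑ a, w a * Real.exp (l * h a) ≤
      Real.exp (l * m + l ^ 2 * v * Real.exp (t / 2)) := by
    calc ∑ a, w a * Real.exp (l * h a)
        ≤ ∑ a, w a * (1 + l * h a + (l * h a) ^ 2 * Real.exp (t / 2)) := by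
          refine Finset.sum_le_sum fun a _ => mul_le_mul_of_nonneg_left ?_ (hw0 a)
          refine exp_le_one_add_add_sq _ _ ?_
          rw [abs_mul, abs_of_nonneg hl0]
          calc l * |h a| ≤ l * H := mul_le_mul_of_nonneg_left (hH a) hl0
            _ = H * α / η * t := by rw [hl]; ring
            _ ≤ 1 / 2 * t := mul_le_mul_of_nonneg_right hHα ht
            _ = t / 2 := by ring
      _ = 1 + l * m + l ^ 2 * v * Real.exp (t / 2) := by
          have : ∀ a, w a * (1 + l * h a + (l * h a) ^ 2 * Real.exp (t / 2)) =
            w a + l * (w a * h a) + l ^ 2 * Real.exp (t / 2) * (w a * h a ^ 2) := by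
            intro a; ring
          simp only [this, Finset.sum_add_distrib, ← Finset.mul_sum, hw]
          ring
      _ ≤ _ := by
          have := Real.add_one_le_exp (l * m + l ^ 2 * v * Real.exp (t / 2))
          linarith
  calc ∑ B : Fin d → Ω, (∏ j, w (B j)) * ind (η ≤ ∑ j, h (B j))
      ≤ ∑ B : Fin d → Ω, (∏ j, w (B j)) * (Real.exp (-(l * η)) * ∏ j, Real.exp (l * h (B j))) := by
        refine Finset.sum_le_sum fun B _ =>
          mul_le_mul_of_nonneg_left ?_ (Finset.prod_nonneg fun j _ => hw0 _)
        rw [← Real.exp_sum, ← Finset.mul_sum, ← Real.exp_add]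
        refine ind_le_of_imp (Real.exp_pos _).le fun hB => Real.one_le_exp ?_
        nlinarith [mul_le_mul_of_nonneg_left hB hl0]
    _ = Real.exp (-(l * η)) * (∑ a, w a * Real.exp (l * h a)) ^ d := by
        simp only [mul_left_comm _ (Real.exp (-(l * η))), ← Finset.mul_sum]
        rw [sum_prod_mul_prod w (fun _ a => Real.exp (l * h a))]
        simp
    _ ≤ Real.exp (-(l * η)) * Real.exp (l * m + l ^ 2 * v * Real.exp (t / 2)) ^ d := by
        refine mul_le_mul_of_nonneg_left (pow_le_pow_left₀ ?_ hmgf _) (Real.exp_pos _).le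
        exact Finset.sum_nonneg fun a _ => mul_nonneg (hw0 a) (Real.exp_pos _).le
    _ ≤ Real.exp (-(l * η)) * Real.exp (c * (2 * (α / η) + 8 * (α / η) ^ 2)) := by
        refine mul_le_mul_of_nonneg_left ?_ (Real.exp_pos _).le
        rw [← Real.exp_nat_mul]
        refine Real.exp_le_exp.2 ?_
        have e1 : (t / 2) ≤ Real.exp (t / 2) := by
          linarith [Real.add_one_le_exp (t / 2)]
        have e2 : (t / 2) ^ 2 ≤ 2 * Real.exp (t / 2) := by
          linarith [Real.quadratic_le_exp_of_nonneg (x := t / 2) (by positivity)]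
        have e3 : Real.exp (-t) * Real.exp (t / 2) * Real.exp (t / 2) = 1 := by
          rw [← Real.exp_add, ← Real.exp_add, ← Real.exp_zero]; congr 1; ring
        have e4 : 1 ≤ Real.exp (t / 2) := Real.one_le_exp (by positivity)
        have hpos := Real.exp_pos (t / 2)
        have hpos' := Real.exp_pos (-t)
        set E := Real.exp (t / 2)
        set x := Real.exp (-t)
        have hb : 0 < α / η := by positivity
        set b := α / η
        have hxE : x * E ≤ 1 := by nlinarith
        calc (d : ℝ) * (l * m + l ^ 2 * v * E)
            = l * (d * m) + l ^ 2 * E * (d * v) := by ring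
          _ ≤ l * (c * x) + l ^ 2 * E * (c * x) := by gcongr
          _ = c * (2 * b * ((t / 2) * x) + 4 * b ^ 2 * ((t / 2) ^ 2 * (x * E))) := by
              rw [hl]; ring
          _ ≤ c * (2 * b * (E * x) + 4 * b ^ 2 * ((2 * E) * (x * E))) := by gcongr
          _ = c * (2 * b * (x * E) + 8 * b ^ 2 * (x * E * E)) := by ring
          _ ≤ c * (2 * b * 1 + 8 * b ^ 2 * 1) := by
              gcongr
              exact e3.le
          _ = _ := by ring
    _ = _ := by
        rw [← Real.exp_mul, mul_comm]
        congr 2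
        rw [hl]
        field_simp

end ProductWeights

/-- The posterior probability of the root spin `1` computed from the posteriors `y` of
the children of the root. -/
noncomputable def combine (π1 π2 θ : ℝ) {d : ℕ} (y : Fin d → ℝ) : ℝ :=
  (π1 * ∏ j, (1 + (θ / π1) * (y j - π1))) /
    (π1 * ∏ j, (1 + (θ / π1) * (y j - π1)) + π2 * ∏ j, (1 - (θ / π2) * (y j - π1)))

lemma one_add_le_mul_exp {a b K W : ℝ} (hb : |b| ≤ K) (hab : |a + b| ≤ 2 * K)
    (hW : K * |W| ≤ 1 / 2) :
    1 + a * W ≤ (1 - b * W) * Real.exp ((a + b) * W + 4 * K ^ 2 * W ^ 2) := by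
  have hbW : |b * W| ≤ 1 / 2 := by
    rw [abs_mul]; exact (mul_le_mul_of_nonneg_right hb (abs_nonneg _)).trans hW
  have h1 := abs_le.1 hbW
  have hs : b * (a + b) ≤ 2 * K ^ 2 := by
    calc b * (a + b) ≤ |b| * |a + b| := by rw [← abs_mul]; exact le_abs_self _
      _ ≤ K * (2 * K) := by gcongr; exact (abs_nonneg b).trans hb
      _ = _ := by ring
  have hexp := Real.add_one_le_exp ((a + b) * W + 4 * K ^ 2 * W ^ 2)
  have h2 := mul_le_mul_of_nonneg_left hexp (by linarith : 0 ≤ 1 - b * W)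
  have h3 := mul_le_mul_of_nonneg_right hs (sq_nonneg W)
  have h4 : 0 ≤ (1 / 2 - b * W) * (4 * K ^ 2 * W ^ 2) :=
    mul_nonneg (by linarith) (by positivity)
  nlinarith

lemma prod_one_add_le {d : ℕ} {a b K : ℝ} {W : Fin d → ℝ} (ha : |a| ≤ K) (hb : |b| ≤ K)
    (hW : ∀ j, K * |W j| ≤ 1 / 2) :
    ∏ j, (1 + a * W j) ≤
      (∏ j, (1 - b * W j)) * Real.exp (∑ j, ((a + b) * W j + 4 * K ^ 2 * W j ^ 2)) := by
  rw [Real.exp_sum, ← Finset.prod_mul_distrib]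
  refine Finset.prod_le_prod (fun j _ => ?_) fun j _ => one_add_le_mul_exp hb ?_ (hW j)
  · have : |a * W j| ≤ 1 / 2 := by
      rw [abs_mul]; exact (mul_le_mul_of_nonneg_right ha (abs_nonneg _)).trans (hW j)
    linarith [(abs_le.1 this).1]
  · exact (abs_add_le a b).trans (by linarith)

lemma mul_lt_or_mul_lt_of_lt_abs {π1 π2 ε Z1 Z2 : ℝ} (h1 : 0 < π1) (h2 : 0 < π2)
    (hsum : π1 + π2 = 1) (hε : 0 < ε) (hZ1 : 0 < Z1) (hZ2 : 0 < Z2)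
    (h : ε < |π1 * Z1 / (π1 * Z1 + π2 * Z2) - π1|) :
    (1 + ε) * Z2 < Z1 ∨ (1 + ε) * Z1 < Z2 := by
  have hD : 0 < π1 * Z1 + π2 * Z2 := by positivity
  have e : π1 * Z1 / (π1 * Z1 + π2 * Z2) - π1 =
      π1 * π2 * (Z1 - Z2) / (π1 * Z1 + π2 * Z2) := by
    have : π1 = 1 - π2 := by linarith
    field_simp
    rw [this]; ring
  have hp : π1 * π2 ≤ 1 := by nlinarith
  rw [e, abs_div, abs_of_pos hD, lt_div_iff₀ hD, abs_mul, abs_of_pos (by positivity)] at h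
  have h3 : π1 * π2 * |Z1 - Z2| ≤ |Z1 - Z2| := mul_le_of_le_one_left (abs_nonneg _) hp
  have hc : ∀ z, z ≤ Z1 → z ≤ Z2 → z ≤ π1 * Z1 + π2 * Z2 := by
    intro z hz1 hz2
    have := mul_le_mul_of_nonneg_left hz1 h1.le
    have := mul_le_mul_of_nonneg_left hz2 h2.le
    have : π1 * z + π2 * z = z := by rw [← add_mul, hsum, one_mul]
    linarith
  rcases le_total Z2 Z1 with hle | hle
  · left
    rw [abs_of_nonneg (by linarith)] at h h3
    have := mul_le_mul_of_nonneg_left (hc Z2 hle le_rfl) hε.le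
    linarith
  · right
    rw [abs_of_nonpos (by linarith)] at h h3
    have := mul_le_mul_of_nonneg_left (hc Z1 le_rfl hle) hε.le
    linarith

/-- Concentration of the combined posterior when the second eigenvalue is small. -/
lemma combine_concentration_of_small {Ω : Type*} [Fintype Ω] {d : ℕ} {π1 π2 θ x ε α : ℝ}
    {w y : Ω → ℝ} (hsum : π1 + π2 = 1) (hord : π2 ≤ π1) (h2 : 0 < π2)
    (hw0 : ∀ a, 0 ≤ w a) (hw : ∑ a, w a = 1) (hy0 : ∀ a, 0 ≤ y a) (hy1 : ∀ a, y a ≤ 1)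
    (hx0 : 0 < x) (hx1 : x ≤ 1) (hdθ : d * θ ^ 2 ≤ 1)
    (hm : ∑ a, w a * (y a - π1) = θ * x) (hv : ∑ a, w a * (y a - π1) ^ 2 ≤ x)
    (hε : 0 < ε) (hα : 0 < α) (hθ1 : π2⁻¹ * |θ| ≤ 1 / 2)
    (hθ2 : 6 * π2⁻¹ ^ 2 * |θ| * α / Real.log (1 + ε) ≤ 1 / 2) :
    ∑ B : Fin d → Ω, (∏ j, w (B j)) * ind (ε < |combine π1 π2 θ (fun j => y (B j)) - π1|) ≤
      2 * Real.exp (36 * π2⁻¹ ^ 4 *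
        (2 * (α / Real.log (1 + ε)) + 8 * (α / Real.log (1 + ε)) ^ 2)) * x ^ α := by
  have h1 : 0 < π1 := h2.trans_le hord
  have hη : 0 < Real.log (1 + ε) := Real.log_pos (by linarith)
  set K := π2⁻¹ with hK
  have hK1 : 1 ≤ K := (one_le_inv₀ h2).2 (by linarith)
  have hKpos : 0 < K := by linarith
  have hK' : π1⁻¹ ≤ K := inv_anti₀ h2 hord
  have hi1 : 0 < π1⁻¹ := inv_pos.2 h1
  set W : Ω → ℝ := fun a => θ * (y a - π1) with hWdef
  have hWθ : ∀ a, |W a| ≤ |θ| := fun a => by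
    rw [hWdef, abs_mul]
    refine mul_le_of_le_one_right (abs_nonneg _) (abs_le.2 ⟨?_, ?_⟩) <;>
      linarith [hy0 a, hy1 a]
  have hθle : |θ| ≤ 1 := by nlinarith [abs_nonneg θ]
  have hKW : ∀ a, K * |W a| ≤ 1 / 2 := fun a =>
    (mul_le_mul_of_nonneg_left (hWθ a) hKpos.le).trans hθ1
  obtain ⟨t, rfl⟩ : ∃ t, x = Real.exp (-t) := ⟨-Real.log x, by simp [Real.exp_log hx0]⟩
  have ht : 0 ≤ t := by
    have := Real.exp_le_one_iff.1 hx1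
    linarith
  set x := Real.exp (-t)
  have habs : ∀ s, |s| ≤ 2 * K → ∀ a, |s * W a + 4 * K ^ 2 * W a ^ 2| ≤ 6 * K ^ 2 * |W a| := by
    intro s hs a
    have hW1 : |W a| ≤ 1 := (hWθ a).trans hθle
    calc |s * W a + 4 * K ^ 2 * W a ^ 2| ≤ |s * W a| + |4 * K ^ 2 * W a ^ 2| := abs_add_le _ _
      _ = |s| * |W a| + 4 * K ^ 2 * (|W a| * |W a|) := by
          rw [abs_mul, abs_of_nonneg (by positivity : 0 ≤ 4 * K ^ 2 * W a ^ 2), ← sq, sq_abs]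
      _ ≤ 2 * K ^ 2 * |W a| + 4 * K ^ 2 * (|W a| * 1) := by
          gcongr
          exact hs.trans (by nlinarith)
      _ = _ := by ring
  have hmW : d * ∑ a, w a * W a ≤ x ∧ 0 ≤ d * ∑ a, w a * W a := by
    have : d * ∑ a, w a * W a = d * θ ^ 2 * x := by
      have e : ∀ a, w a * W a = θ * (w a * (y a - π1)) := fun a => by rw [hWdef]; ring
      simp only [e, ← Finset.mul_sum, hm]; ring
    rw [this]
    exact ⟨mul_le_of_le_one_left hx0.le hdθ, by positivity⟩
  have hvW : d * ∑ a, w a * W a ^ 2 ≤ x := by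
    have e : ∀ a, w a * W a ^ 2 = θ ^ 2 * (w a * (y a - π1) ^ 2) := fun a => by
      rw [hWdef]; ring
    simp only [e, ← Finset.mul_sum]
    calc (d : ℝ) * (θ ^ 2 * ∑ a, w a * (y a - π1) ^ 2)
        ≤ d * (θ ^ 2 * x) := by gcongr
      _ = d * θ ^ 2 * x := by ring
      _ ≤ x := mul_le_of_le_one_left hx0.le hdθ
  have hK4 : K ^ 2 ≤ K ^ 4 := pow_le_pow_right₀ hK1 (by norm_num)
  have hKK : K ≤ K ^ 2 := by nlinarith
  have main : ∀ s, |s| ≤ 2 * K →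
      ∑ B : Fin d → Ω, (∏ j, w (B j)) *
        ind (Real.log (1 + ε) ≤ ∑ j, (s * W (B j) + 4 * K ^ 2 * W (B j) ^ 2)) ≤
      Real.exp (36 * K ^ 4 *
        (2 * (α / Real.log (1 + ε)) + 8 * (α / Real.log (1 + ε)) ^ 2)) * x ^ α := by
    intro s hs
    refine chernoff_bound hw0 hw (fun a => s * W a + 4 * K ^ 2 * W a ^ 2)
      (H := 6 * K ^ 2 * |θ|) (fun a => (habs s hs a).trans ?_) ht hη hα (by positivity) ?_ ?_ hθ2
    · exact mul_le_mul_of_nonneg_left (hWθ a) (by positivity)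
    · have e : ∀ a, w a * (s * W a + 4 * K ^ 2 * W a ^ 2) =
          s * (w a * W a) + 4 * K ^ 2 * (w a * W a ^ 2) := fun a => by ring
      simp only [e, Finset.sum_add_distrib, ← Finset.mul_sum]
      calc (d : ℝ) * (s * ∑ a, w a * W a + 4 * K ^ 2 * ∑ a, w a * W a ^ 2)
          = s * (d * ∑ a, w a * W a) + 4 * K ^ 2 * (d * ∑ a, w a * W a ^ 2) := by ring
        _ ≤ 2 * K * x + 4 * K ^ 2 * x := by
            refine add_le_add ?_ (mul_le_mul_of_nonneg_left hvW (by positivity))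
            exact mul_le_mul ((le_abs_self s).trans hs) hmW.1 hmW.2 (by positivity)
        _ = (2 * K + 4 * K ^ 2) * x := by ring
        _ ≤ 36 * K ^ 4 * x := mul_le_mul_of_nonneg_right (by nlinarith) hx0.le
    · have e : ∀ a, w a * (s * W a + 4 * K ^ 2 * W a ^ 2) ^ 2 ≤
          36 * K ^ 4 * (w a * W a ^ 2) := fun a => by
        have := pow_le_pow_left₀ (abs_nonneg _) (habs s hs a) 2
        rw [sq_abs, mul_pow _ |W a|, sq_abs] at this
        have := mul_le_mul_of_nonneg_left this (hw0 a)
        linarith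
      calc (d : ℝ) * ∑ a, w a * (s * W a + 4 * K ^ 2 * W a ^ 2) ^ 2
          ≤ d * ∑ a, 36 * K ^ 4 * (w a * W a ^ 2) := by
            exact mul_le_mul_of_nonneg_left (Finset.sum_le_sum fun a _ => e a) d.cast_nonneg
        _ = 36 * K ^ 4 * (d * ∑ a, w a * W a ^ 2) := by rw [← Finset.mul_sum]; ring
        _ ≤ 36 * K ^ 4 * x := by gcongr
  have habound : |π1⁻¹| ≤ K := by rwa [abs_of_pos hi1]
  have hbbound : |K| ≤ K := (abs_of_pos hKpos).le
  have hs1 : |π1⁻¹ + K| ≤ 2 * K := by rw [abs_of_pos (by positivity)]; linarith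
  have hs2 : |-K + -π1⁻¹| ≤ 2 * K := by
    rw [← neg_add, abs_neg, add_comm]; exact hs1
  have hfac : ∀ c, |c| ≤ K → ∀ a, 0 < 1 + c * W a := fun c hc a => by
    have : |c * W a| ≤ 1 / 2 := by
      rw [abs_mul]; exact (mul_le_mul_of_nonneg_right hc (abs_nonneg _)).trans (hKW a)
    linarith [(abs_le.1 this).1]
  have hind : ∀ B : Fin d → Ω, ind (ε < |combine π1 π2 θ (fun j => y (B j)) - π1|) ≤
      ind (Real.log (1 + ε) ≤ ∑ j, ((π1⁻¹ + K) * W (B j) + 4 * K ^ 2 * W (B j) ^ 2)) +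
      ind (Real.log (1 + ε) ≤ ∑ j, ((-K + -π1⁻¹) * W (B j) + 4 * K ^ 2 * W (B j) ^ 2)) := by
    intro B
    refine ind_le_of_imp (add_nonneg (ind_nonneg _) (ind_nonneg _)) fun hB => ?_
    have eZ1 : ∏ j, (1 + (θ / π1) * (y (B j) - π1)) = ∏ j, (1 + π1⁻¹ * W (B j)) :=
      Finset.prod_congr rfl fun j _ => by rw [hWdef]; ring
    have eZ2 : ∏ j, (1 - (θ / π2) * (y (B j) - π1)) = ∏ j, (1 - K * W (B j)) :=
      Finset.prod_congr rfl fun j _ => by rw [hWdef, hK]; ring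
    have eZ2' : ∏ j, (1 - K * W (B j)) = ∏ j, (1 + -K * W (B j)) :=
      Finset.prod_congr rfl fun j _ => by ring
    have eZ1' : ∏ j, (1 + π1⁻¹ * W (B j)) = ∏ j, (1 - -π1⁻¹ * W (B j)) :=
      Finset.prod_congr rfl fun j _ => by ring
    have hZ1 : 0 < ∏ j, (1 + π1⁻¹ * W (B j)) :=
      Finset.prod_pos fun j _ => hfac _ habound _
    have hZ2 : 0 < ∏ j, (1 - K * W (B j)) := by
      rw [eZ2']
      exact Finset.prod_pos fun j _ => hfac _ (by rwa [abs_neg]) _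
    rw [combine, eZ1, eZ2] at hB
    rcases mul_lt_or_mul_lt_of_lt_abs h1 h2 hsum hε hZ1 hZ2 hB with h | h
    · have := prod_one_add_le habound hbbound (fun j => hKW (B j))
      rw [ind_of]
      · linarith [ind_nonneg (Real.log (1 + ε) ≤
          ∑ j, ((-K + -π1⁻¹) * W (B j) + 4 * K ^ 2 * W (B j) ^ 2))]
      rw [Real.log_le_iff_le_exp (by linarith)]
      refine le_of_mul_le_mul_right ?_ hZ2
      linarith
    · have := prod_one_add_le (a := -K) (b := -π1⁻¹) (by rwa [abs_neg]) (by rwa [abs_neg])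
        (fun j => hKW (B j))
      rw [← eZ2', ← eZ1'] at this
      rw [add_comm, ind_of]
      · linarith [ind_nonneg (Real.log (1 + ε) ≤
          ∑ j, ((π1⁻¹ + K) * W (B j) + 4 * K ^ 2 * W (B j) ^ 2))]
      rw [Real.log_le_iff_le_exp (by linarith)]
      refine le_of_mul_le_mul_right ?_ hZ1
      linarith
  calc _ ≤ ∑ B : Fin d → Ω, (∏ j, w (B j)) *
      (ind (Real.log (1 + ε) ≤ ∑ j, ((π1⁻¹ + K) * W (B j) + 4 * K ^ 2 * W (B j) ^ 2)) +
      ind (Real.log (1 + ε) ≤ ∑ j, ((-K + -π1⁻¹) * W (B j) + 4 * K ^ 2 * W (B j) ^ 2))) :=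
        Finset.sum_le_sum fun B _ =>
          mul_le_mul_of_nonneg_left (hind B) (Finset.prod_nonneg fun j _ => hw0 _)
    _ ≤ _ := by
        simp only [mul_add (∏ j, w _),
          Finset.sum_add_distrib (s := (Finset.univ : Finset (Fin d → Ω)))]
        rw [two_mul, add_mul]
        exact add_le_add (main _ hs1) (main _ hs2)

lemma abs_prod_one_add_sub_one_le {ι : Type*} (s : Finset ι) (u : ι → ℝ) {D r : ℝ}
    (hs : (s.card : ℝ) ≤ D) (hr : 0 ≤ r) (hu : ∀ i ∈ s, |u i| ≤ r) :
    |∏ i ∈ s, (1 + u i) - 1| ≤ Real.exp (D * r) - 1 := by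
  refine (Finset.norm_prod_one_add_sub_one_le s u).trans ?_
  gcongr
  calc ∑ i ∈ s, ‖u i‖ ≤ ∑ i ∈ s, r := Finset.sum_le_sum hu
    _ = s.card * r := by simp
    _ ≤ D * r := by gcongr

/-- If all children but one have posteriors close to the prior, then the deviation of the
remaining child is contracted. -/
lemma abs_combine_sub_le {d : ℕ} {π1 π2 θ ε δ D : ℝ} {y : Fin d → ℝ} (hsum : π1 + π2 = 1)
    (hord : π2 ≤ π1) (h2 : 0 < π2) (hθ : θ ^ 2 ≤ 1 / 2) (hε0 : 0 < ε) (hε1 : ε < 1)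
    (hD : (d : ℝ) ≤ D) (hδ0 : 0 ≤ δ) (hδ : D * (π2⁻¹ * δ) ≤ Real.log (1 + ε / 40))
    (i : Fin d) (hp : 0 ≤ π1 + θ * (y i - π1)) (hq : 0 ≤ π2 - θ * (y i - π1))
    (hi : |y i - π1| ≤ 6 / 5 * ε) (hj : ∀ j, j ≠ i → |y j - π1| ≤ δ) :
    |combine π1 π2 θ y - π1| ≤ ε := by
  have h1 : 0 < π1 := h2.trans_le hord
  have hθ' : |θ| ≤ 3 / 4 := abs_le_of_sq_le_sq (by nlinarith) (by norm_num)
  have hK' : π1⁻¹ ≤ π2⁻¹ := inv_anti₀ h2 hord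
  have hi1 : 0 < π1⁻¹ := inv_pos.2 h1
  have hi2 : 0 < π2⁻¹ := inv_pos.2 h2
  have hcard : (((Finset.univ.erase i).card : ℕ) : ℝ) ≤ D := by
    refine le_trans ?_ hD
    exact_mod_cast (Finset.card_le_univ _).trans (Fintype.card_fin d).le
  have hexp : Real.exp (D * (π2⁻¹ * δ)) - 1 ≤ ε / 40 := by
    have := Real.exp_le_exp.2 hδ
    rw [Real.exp_log (by positivity)] at this
    linarith
  have hbd : ∀ c, |c| ≤ π2⁻¹ →
      |∏ j ∈ Finset.univ.erase i, (1 + c * θ * (y j - π1)) - 1| ≤ ε / 40 := by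
    intro c hc
    refine (abs_prod_one_add_sub_one_le _ (fun j => c * θ * (y j - π1)) hcard
      (by positivity) fun j hjm => ?_).trans hexp
    rw [abs_mul, abs_mul]
    calc |c| * |θ| * |y j - π1| ≤ π2⁻¹ * 1 * δ := by
          gcongr
          · linarith
          · exact hj j (Finset.ne_of_mem_erase hjm)
      _ = _ := by ring
  set P := ∏ j ∈ Finset.univ.erase i, (1 + π1⁻¹ * θ * (y j - π1)) with hP
  set Q := ∏ j ∈ Finset.univ.erase i, (1 + -π2⁻¹ * θ * (y j - π1)) with hQ
  have hPb : |P - 1| ≤ ε / 40 := hbd _ (by rwa [abs_of_pos hi1])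
  have hQb : |Q - 1| ≤ ε / 40 := hbd _ (by rw [abs_neg, abs_of_pos hi2])
  set p := π1 + θ * (y i - π1) with hpdef
  set q := π2 - θ * (y i - π1) with hqdef
  have e1 : π1 * ∏ j, (1 + (θ / π1) * (y j - π1)) = p * P := by
    rw [← Finset.mul_prod_erase _ _ (Finset.mem_univ i), ← mul_assoc]
    congr 1
    · rw [hpdef]; field_simp
    · exact Finset.prod_congr rfl fun j _ => by ring
  have e2 : π2 * ∏ j, (1 - (θ / π2) * (y j - π1)) = q * Q := by
    rw [← Finset.mul_prod_erase _ _ (Finset.mem_univ i), ← mul_assoc]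
    congr 1
    · rw [hqdef]; field_simp
    · exact Finset.prod_congr rfl fun j _ => by ring
  rw [combine, e1, e2]
  have hpq : p + q = 1 := by rw [hpdef, hqdef]; linarith
  have hP' := abs_le.1 hPb
  have hQ' := abs_le.1 hQb
  have hDpos : 1 / 2 ≤ p * P + q * Q := by
    have := mul_le_mul_of_nonneg_left (by linarith : 1 / 2 ≤ P) hp
    have := mul_le_mul_of_nonneg_left (by linarith : 1 / 2 ≤ Q) hq
    linarith
  have e3 : p * P / (p * P + q * Q) - p = p * q * (P - Q) / (p * P + q * Q) := by
    have : q = 1 - p := by linarith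
    have hne : p * P + q * Q ≠ 0 := by linarith
    rw [this] at hne ⊢
    field_simp
    ring
  have hdev : |p * P / (p * P + q * Q) - p| ≤ ε / 10 := by
    rw [e3, abs_div, abs_of_pos (by linarith : 0 < p * P + q * Q),
      div_le_iff₀ (by linarith), abs_mul, abs_of_nonneg (mul_nonneg hp hq)]
    have hPQ : |P - Q| ≤ ε / 20 := abs_le.2 ⟨by linarith, by linarith⟩
    have hpq1 : p * q ≤ 1 := by nlinarith
    have := mul_le_of_le_one_left (abs_nonneg (P - Q)) hpq1
    have := mul_le_mul_of_nonneg_left hDpos (by positivity : 0 ≤ ε / 10)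
    linarith
  have hpd : |p - π1| ≤ 9 / 10 * ε := by
    have : p - π1 = θ * (y i - π1) := by rw [hpdef]; ring
    rw [this, abs_mul]
    calc |θ| * |y i - π1| ≤ 3 / 4 * (6 / 5 * ε) := by gcongr
      _ = _ := by ring
  calc |p * P / (p * P + q * Q) - π1|
      ≤ |p * P / (p * P + q * Q) - p| + |p - π1| := abs_sub_le _ _ _
    _ ≤ ε := by linarith

/-- The standing assumptions on the parameters of the broadcast process. -/
structure Admissible (π1 π2 : ℝ) (d : ℕ) (θ : ℝ) : Prop where
  sum_eq : π1 + π2 = 1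
  le : π2 ≤ π1
  pos : 0 < π2
  two_le : 2 ≤ d
  ne_zero : θ ≠ 0
  entry_pos : ∀ i j, 0 < Mmat θ (Dlt θ π1 π2) i j
  lower : 1 / 2 ≤ (d : ℝ) * θ ^ 2
  upper : (d : ℝ) * θ ^ 2 ≤ 1

/-- The law of the spins below a child of the root, given the spin `i` of the root. -/
noncomputable def childLaw (d : ℕ) (θ Δ : ℝ) (n : ℕ) (i : Fin 2) (B : LConf d n) : ℝ :=
  ∑ s, Mmat θ Δ i s * lik d θ Δ n s B

lemma sum_lik_succ (d : ℕ) (θ Δ : ℝ) (n : ℕ) (i : Fin 2) (F : (Fin d → LConf d n) → ℝ) :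
    ∑ A : LConf d (n + 1), lik d θ Δ (n + 1) i A * F (fun j => restrictChild j A) =
      ∑ B : Fin d → LConf d n, (∏ j, childLaw d θ Δ n i (B j)) * F B := by
  rw [← sum_levelEquiv d n fun B => (∏ j, childLaw d θ Δ n i (B j)) * F B]
  simp only [lik_succ, childLaw]

/-- The total mass, under both conditional laws, of the event that the posterior deviates
from the prior by more than `ε`. -/
noncomputable def dev (π1 π2 : ℝ) (d : ℕ) (θ : ℝ) (n : ℕ) (ε : ℝ) : ℝ :=
  ∑ A : LConf d n, (lik d θ (Dlt θ π1 π2) n 0 A + lik d θ (Dlt θ π1 π2) n 1 A) *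
    ind (ε < |post d θ (Dlt θ π1 π2) n 0 A - π1|)

namespace Admissible

variable {π1 π2 : ℝ} {d : ℕ} {θ : ℝ}

lemma pos' (h : Admissible π1 π2 d θ) : 0 < π1 := h.pos.trans_le h.le

lemma theta_sq_le (h : Admissible π1 π2 d θ) : θ ^ 2 ≤ 1 / 2 := by
  have h1 : (2 : ℝ) ≤ d := by exact_mod_cast h.two_le
  nlinarith [h.upper, mul_le_mul_of_nonneg_right h1 (sq_nonneg θ)]

lemma theta_lt (h : Admissible π1 π2 d θ) : θ < 1 := by
  nlinarith [h.theta_sq_le]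

lemma pst_zero (h : Admissible π1 π2 d θ) : pst θ (Dlt θ π1 π2) 0 = π1 := by
  have h1 : 1 - θ ≠ 0 := by linarith [h.theta_lt]
  have h2 : π2 = 1 - π1 := by linarith [h.sum_eq]
  simp only [pst, Dlt, if_true, h2]
  field_simp
  ring

lemma pst_one (h : Admissible π1 π2 d θ) : pst θ (Dlt θ π1 π2) 1 = π2 := by
  have h1 : 1 - θ ≠ 0 := by linarith [h.theta_lt]
  have h2 : π1 = 1 - π2 := by linarith [h.sum_eq]
  simp only [pst, Dlt, one_ne_zero, if_false, h2]
  field_simp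
  ring

lemma mmat_eq (h : Admissible π1 π2 d θ) :
    Mmat θ (Dlt θ π1 π2) 0 0 = π1 + θ * π2 ∧ Mmat θ (Dlt θ π1 π2) 0 1 = (1 - θ) * π2 ∧
    Mmat θ (Dlt θ π1 π2) 1 0 = (1 - θ) * π1 ∧ Mmat θ (Dlt θ π1 π2) 1 1 = π2 + θ * π1 := by
  have h2 : π2 = 1 - π1 := by linarith [h.sum_eq]
  simp only [Mmat, Dlt, if_true, one_ne_zero, if_false, h2]
  refine ⟨?_, ?_, ?_, ?_⟩ <;> ring

lemma sum_mmat (h : Admissible π1 π2 d θ) (i : Fin 2) :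
    ∑ s, Mmat θ (Dlt θ π1 π2) i s = 1 := by
  obtain ⟨h1, h2, h3, h4⟩ := h.mmat_eq
  rw [Fin.sum_univ_two]
  fin_cases i
  · simp only [Fin.zero_eta, h1, h2]; linarith [h.sum_eq]
  · simp only [Fin.mk_one, h3, h4]; linarith [h.sum_eq]

lemma lik_nonneg (h : Admissible π1 π2 d θ) (n : ℕ) (i : Fin 2) (A : LConf d n) :
    0 ≤ lik d θ (Dlt θ π1 π2) n i A := by
  refine Finset.sum_nonneg fun σ _ => ?_
  split_ifs
  · exact Finset.prod_nonneg fun k _ => Finset.prod_nonneg fun v _ => (h.entry_pos _ _).le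
  · exact le_rfl

lemma exists_lik_pos (h : Admissible π1 π2 d θ) (n : ℕ) (A : LConf d n) :
    ∃ i, 0 < lik d θ (Dlt θ π1 π2) n i A := by
  induction n with
  | zero => exact ⟨A fun i => i.elim0, by rw [lik_zero, if_pos rfl]; exact one_pos⟩
  | succ n ih =>
    refine ⟨0, ?_⟩
    rw [lik_succ]
    refine Finset.prod_pos fun j _ => ?_
    obtain ⟨s, hs⟩ := ih (restrictChild j A)
    exact Finset.sum_pos' (fun _ _ => mul_nonneg (h.entry_pos _ _).le (h.lik_nonneg _ _ _))
      ⟨s, Finset.mem_univ s, mul_pos (h.entry_pos _ _) hs⟩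

lemma sum_childLaw_mul (n : ℕ) (i : Fin 2) (g : LConf d n → ℝ) :
    ∑ B, childLaw d θ (Dlt θ π1 π2) n i B * g B =
      Mmat θ (Dlt θ π1 π2) i 0 * ∑ B, lik d θ (Dlt θ π1 π2) n 0 B * g B +
      Mmat θ (Dlt θ π1 π2) i 1 * ∑ B, lik d θ (Dlt θ π1 π2) n 1 B * g B := by
  simp only [childLaw, Fin.sum_univ_two, add_mul, Finset.sum_add_distrib, Finset.mul_sum,
    mul_assoc]

lemma childLaw_nonneg (h : Admissible π1 π2 d θ) (n : ℕ) (i : Fin 2) (B : LConf d n) :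
    0 ≤ childLaw d θ (Dlt θ π1 π2) n i B :=
  Finset.sum_nonneg fun _ _ => mul_nonneg (h.entry_pos _ _).le (h.lik_nonneg _ _ _)

lemma sum_childLaw_of_sum_lik (h : Admissible π1 π2 d θ) {n : ℕ}
    (hn : ∀ i, ∑ A, lik d θ (Dlt θ π1 π2) n i A = 1) (i : Fin 2) :
    ∑ B, childLaw d θ (Dlt θ π1 π2) n i B = 1 := by
  have := sum_childLaw_mul (d := d) (θ := θ) (π1 := π1) (π2 := π2) n i fun _ => 1
  simp only [mul_one, hn] at this
  rw [this, ← Fin.sum_univ_two (Mmat θ (Dlt θ π1 π2) i), h.sum_mmat]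

lemma sum_lik (h : Admissible π1 π2 d θ) (n : ℕ) (i : Fin 2) :
    ∑ A, lik d θ (Dlt θ π1 π2) n i A = 1 := by
  induction n generalizing i with
  | zero =>
    simp only [lik_zero]
    rw [Finset.sum_eq_single (fun _ => i)]
    · simp
    · intro A _ hA
      refine if_neg fun hi => hA ?_
      funext v
      rw [← hi]
      exact congrArg A (funext fun k => k.elim0)
    · simp
  | succ n ih =>
    have := sum_lik_succ d θ (Dlt θ π1 π2) n i fun _ => 1
    simp only [mul_one] at this
    rw [this]
    exact sum_prod_weight (h.sum_childLaw_of_sum_lik ih i)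

lemma sum_childLaw (h : Admissible π1 π2 d θ) (n : ℕ) (i : Fin 2) :
    ∑ B, childLaw d θ (Dlt θ π1 π2) n i B = 1 :=
  h.sum_childLaw_of_sum_lik (h.sum_lik n) i

lemma condLevel_zero (h : Admissible π1 π2 d θ) (n : ℕ) (A : LConf d n) :
    condLevel d θ (Dlt θ π1 π2) n 0 A = lik d θ (Dlt θ π1 π2) n 0 A := by
  rw [condLevel, jointProb_eq, h.pst_zero, mul_div_cancel_left₀ _ h.pos'.ne']

lemma post_eq (h : Admissible π1 π2 d θ) (n : ℕ) (A : LConf d n) :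
    post d θ (Dlt θ π1 π2) n 0 A = π1 * lik d θ (Dlt θ π1 π2) n 0 A /
      (π1 * lik d θ (Dlt θ π1 π2) n 0 A + π2 * lik d θ (Dlt θ π1 π2) n 1 A) := by
  rw [post, levelProb_eq, jointProb_eq, h.pst_zero, h.pst_one]

lemma level_pos (h : Admissible π1 π2 d θ) (n : ℕ) (A : LConf d n) :
    0 < π1 * lik d θ (Dlt θ π1 π2) n 0 A + π2 * lik d θ (Dlt θ π1 π2) n 1 A := by
  obtain ⟨i, hi⟩ := h.exists_lik_pos n A
  have h0 := mul_nonneg h.pos'.le (h.lik_nonneg n 0 A)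
  have h1 := mul_nonneg h.pos.le (h.lik_nonneg n 1 A)
  fin_cases i
  · have hi' : 0 < lik d θ (Dlt θ π1 π2) n 0 A := hi
    linarith [mul_pos h.pos' hi']
  · have hi' : 0 < lik d θ (Dlt θ π1 π2) n 1 A := hi
    linarith [mul_pos h.pos hi']

lemma level_mul_post (h : Admissible π1 π2 d θ) (n : ℕ) (A : LConf d n) :
    (π1 * lik d θ (Dlt θ π1 π2) n 0 A + π2 * lik d θ (Dlt θ π1 π2) n 1 A) *
      post d θ (Dlt θ π1 π2) n 0 A = π1 * lik d θ (Dlt θ π1 π2) n 0 A := by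
  rw [h.post_eq, mul_div_cancel₀ _ (h.level_pos n A).ne']

lemma post_nonneg (h : Admissible π1 π2 d θ) (n : ℕ) (A : LConf d n) :
    0 ≤ post d θ (Dlt θ π1 π2) n 0 A := by
  rw [h.post_eq]
  exact div_nonneg (mul_nonneg h.pos'.le (h.lik_nonneg n 0 A)) (h.level_pos n A).le

lemma post_le_one (h : Admissible π1 π2 d θ) (n : ℕ) (A : LConf d n) :
    post d θ (Dlt θ π1 π2) n 0 A ≤ 1 := by
  rw [h.post_eq]
  exact div_le_one_of_le₀ (by linarith [mul_nonneg h.pos.le (h.lik_nonneg n 1 A)])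
    (h.level_pos n A).le

lemma xseq_eq (h : Admissible π1 π2 d θ) (n : ℕ) :
    xseq d θ (Dlt θ π1 π2) n = ∑ A, lik d θ (Dlt θ π1 π2) n 0 A *
      (post d θ (Dlt θ π1 π2) n 0 A - π1) := by
  simp only [xseq, expect1, h.condLevel_zero, h.pst_zero, mul_sub, Finset.sum_sub_distrib,
    ← Finset.sum_mul, h.sum_lik, one_mul]

lemma sum_lik_one_mul (h : Admissible π1 π2 d θ) (n : ℕ) :
    π2 * ∑ A, lik d θ (Dlt θ π1 π2) n 1 A * (post d θ (Dlt θ π1 π2) n 0 A - π1) =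
      -(π1 * xseq d θ (Dlt θ π1 π2) n) := by
  have e : ∀ A, π2 * (lik d θ (Dlt θ π1 π2) n 1 A * (post d θ (Dlt θ π1 π2) n 0 A - π1)) =
      -(π1 * (lik d θ (Dlt θ π1 π2) n 0 A * (post d θ (Dlt θ π1 π2) n 0 A - π1))) +
      π1 * π2 * (lik d θ (Dlt θ π1 π2) n 0 A - lik d θ (Dlt θ π1 π2) n 1 A) := by
    intro A
    have := h.level_mul_post n A
    have h2 : π2 = 1 - π1 := by linarith [h.sum_eq]
    subst h2
    linear_combination this
  rw [h.xseq_eq, Finset.mul_sum, Finset.sum_congr rfl fun A _ => e A]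
  simp only [Finset.sum_add_distrib, Finset.sum_neg_distrib, ← Finset.mul_sum,
    Finset.sum_sub_distrib, h.sum_lik]
  ring

lemma sum_level_mul_sq (h : Admissible π1 π2 d θ) (n : ℕ) :
    ∑ A, (π1 * lik d θ (Dlt θ π1 π2) n 0 A + π2 * lik d θ (Dlt θ π1 π2) n 1 A) *
      (post d θ (Dlt θ π1 π2) n 0 A - π1) ^ 2 = π1 * xseq d θ (Dlt θ π1 π2) n := by
  have e : ∀ A, (π1 * lik d θ (Dlt θ π1 π2) n 0 A + π2 * lik d θ (Dlt θ π1 π2) n 1 A) *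
      (post d θ (Dlt θ π1 π2) n 0 A - π1) ^ 2 =
      π1 * (lik d θ (Dlt θ π1 π2) n 0 A * (post d θ (Dlt θ π1 π2) n 0 A - π1)) -
      π1 ^ 2 * π2 * (lik d θ (Dlt θ π1 π2) n 0 A - lik d θ (Dlt θ π1 π2) n 1 A) := by
    intro A
    have := h.level_mul_post n A
    have h2 : π2 = 1 - π1 := by linarith [h.sum_eq]
    subst h2
    linear_combination (post d θ (Dlt θ π1 (1 - π1)) n 0 A - 2 * π1) * this
  rw [h.xseq_eq, Finset.sum_congr rfl fun A _ => e A]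
  simp only [← Finset.mul_sum, Finset.sum_sub_distrib, h.sum_lik]
  ring

lemma xseq_le_one (h : Admissible π1 π2 d θ) (n : ℕ) : xseq d θ (Dlt θ π1 π2) n ≤ 1 := by
  rw [h.xseq_eq, ← h.sum_lik n 0]
  refine Finset.sum_le_sum fun A _ => mul_le_of_le_one_right (h.lik_nonneg n 0 A) ?_
  linarith [h.post_le_one n A, h.pos']

lemma xseq_zero (h : Admissible π1 π2 d θ) : xseq d θ (Dlt θ π1 π2) 0 = π2 := by
  have e : ∀ A, lik d θ (Dlt θ π1 π2) 0 0 A * (post d θ (Dlt θ π1 π2) 0 0 A - π1) =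
      lik d θ (Dlt θ π1 π2) 0 0 A * π2 := by
    intro A
    have hp := h.pos'.ne'
    by_cases hA : A (fun i => i.elim0) = 0
    · rw [h.post_eq]
      simp only [lik_zero, hA, if_true, zero_ne_one, if_false, mul_one, mul_zero, add_zero,
        div_self hp, one_mul]
      linarith [h.sum_eq]
    · simp [lik_zero, hA]
  rw [h.xseq_eq, Finset.sum_congr rfl fun A _ => e A, ← Finset.sum_mul, h.sum_lik, one_mul]

lemma sum_childLaw_zero_mul (h : Admissible π1 π2 d θ) (n : ℕ) :
    ∑ B, childLaw d θ (Dlt θ π1 π2) n 0 B * (post d θ (Dlt θ π1 π2) n 0 B - π1) =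
      θ * xseq d θ (Dlt θ π1 π2) n := by
  obtain ⟨h1, h2, -, -⟩ := h.mmat_eq
  have e := h.sum_lik_one_mul n
  rw [sum_childLaw_mul, ← h.xseq_eq, h1, h2]
  have := h.sum_eq
  linear_combination (1 - θ) * e + θ * xseq d θ (Dlt θ π1 π2) n * this

lemma sum_childLaw_one_mul (h : Admissible π1 π2 d θ) (n : ℕ) :
    π2 * ∑ B, childLaw d θ (Dlt θ π1 π2) n 1 B * (post d θ (Dlt θ π1 π2) n 0 B - π1) =
      -(θ * π1 * xseq d θ (Dlt θ π1 π2) n) := by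
  obtain ⟨-, -, h3, h4⟩ := h.mmat_eq
  have e := h.sum_lik_one_mul n
  rw [sum_childLaw_mul, ← h.xseq_eq, h3, h4]
  have := h.sum_eq
  linear_combination (π2 + θ * π1) * e - θ * π1 * xseq d θ (Dlt θ π1 π2) n * this

lemma stationary (h : Admissible π1 π2 d θ) (n : ℕ) (B : LConf d n) :
    π1 * childLaw d θ (Dlt θ π1 π2) n 0 B + π2 * childLaw d θ (Dlt θ π1 π2) n 1 B =
      π1 * lik d θ (Dlt θ π1 π2) n 0 B + π2 * lik d θ (Dlt θ π1 π2) n 1 B := by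
  obtain ⟨h1, h2, h3, h4⟩ := h.mmat_eq
  have hs : π2 = 1 - π1 := by linarith [h.sum_eq]
  simp only [childLaw, Fin.sum_univ_two, h1, h2, h3, h4]
  generalize lik d θ (Dlt θ π1 π2) n 0 B = u
  generalize lik d θ (Dlt θ π1 π2) n 1 B = v
  rw [hs]
  ring

lemma sum_childLaw_zero_mul_sq_le (h : Admissible π1 π2 d θ) (n : ℕ) :
    ∑ B, childLaw d θ (Dlt θ π1 π2) n 0 B * (post d θ (Dlt θ π1 π2) n 0 B - π1) ^ 2 ≤
      xseq d θ (Dlt θ π1 π2) n := by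
  refine le_of_mul_le_mul_left ?_ h.pos'
  rw [← h.sum_level_mul_sq, Finset.mul_sum]
  refine Finset.sum_le_sum fun B _ => ?_
  rw [← h.stationary, ← mul_assoc]
  refine mul_le_mul_of_nonneg_right ?_ (sq_nonneg _)
  linarith [mul_nonneg h.pos.le (h.childLaw_nonneg n 1 B)]

lemma childLaw_zero_eq (h : Admissible π1 π2 d θ) (n : ℕ) (B : LConf d n) :
    childLaw d θ (Dlt θ π1 π2) n 0 B =
      (π1 * lik d θ (Dlt θ π1 π2) n 0 B + π2 * lik d θ (Dlt θ π1 π2) n 1 B) *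
      (1 + (θ / π1) * (post d θ (Dlt θ π1 π2) n 0 B - π1)) := by
  obtain ⟨h1, h2, -, -⟩ := h.mmat_eq
  have e := h.level_mul_post n B
  have hs : π2 = 1 - π1 := by linarith [h.sum_eq]
  have hp := h.pos'.ne'
  simp only [childLaw, Fin.sum_univ_two, h1, h2]
  generalize lik d θ (Dlt θ π1 π2) n 0 B = u at *
  generalize lik d θ (Dlt θ π1 π2) n 1 B = v at *
  generalize post d θ (Dlt θ π1 π2) n 0 B = y at *
  subst hs
  field_simp
  linear_combination (-θ) * e

lemma childLaw_one_eq (h : Admissible π1 π2 d θ) (n : ℕ) (B : LConf d n) :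
    childLaw d θ (Dlt θ π1 π2) n 1 B =
      (π1 * lik d θ (Dlt θ π1 π2) n 0 B + π2 * lik d θ (Dlt θ π1 π2) n 1 B) *
      (1 - (θ / π2) * (post d θ (Dlt θ π1 π2) n 0 B - π1)) := by
  obtain ⟨-, -, h3, h4⟩ := h.mmat_eq
  have e := h.level_mul_post n B
  have hs : π1 = 1 - π2 := by linarith [h.sum_eq]
  have hp := h.pos.ne'
  simp only [childLaw, Fin.sum_univ_two, h3, h4]
  generalize lik d θ (Dlt θ π1 π2) n 0 B = u at *
  generalize lik d θ (Dlt θ π1 π2) n 1 B = v at *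
  generalize post d θ (Dlt θ π1 π2) n 0 B = y at *
  subst hs
  field_simp
  linear_combination θ * e

lemma post_succ (h : Admissible π1 π2 d θ) (n : ℕ) (A : LConf d (n + 1)) :
    post d θ (Dlt θ π1 π2) (n + 1) 0 A =
      combine π1 π2 θ (fun j => post d θ (Dlt θ π1 π2) n 0 (restrictChild j A)) := by
  have e : ∀ i, lik d θ (Dlt θ π1 π2) (n + 1) i A =
      ∏ j, childLaw d θ (Dlt θ π1 π2) n i (restrictChild j A) := fun i => lik_succ _ _ _ _ _ _
  have hpos : 0 < ∏ j, (π1 * lik d θ (Dlt θ π1 π2) n 0 (restrictChild j A) +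
      π2 * lik d θ (Dlt θ π1 π2) n 1 (restrictChild j A)) :=
    Finset.prod_pos fun j _ => h.level_pos n _
  rw [h.post_eq, e, e, combine]
  simp only [h.childLaw_zero_eq, h.childLaw_one_eq, Finset.prod_mul_distrib]
  rw [mul_left_comm π1, mul_left_comm π2, ← mul_add, mul_div_mul_left _ _ hpos.ne']

lemma theta_sq_mul_xseq_le (h : Admissible π1 π2 d θ) (n : ℕ) :
    θ ^ 2 * xseq d θ (Dlt θ π1 π2) n ≤ xseq d θ (Dlt θ π1 π2) (n + 1) := by
  set Δ := Dlt θ π1 π2 with hΔ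
  have j0 : Fin d := ⟨0, by linarith [h.two_le]⟩
  have marg : ∀ (i : Fin 2) (g : LConf d n → ℝ),
      ∑ A, lik d θ Δ (n + 1) i A * g (restrictChild j0 A) = ∑ B, childLaw d θ Δ n i B * g B := by
    intro i g
    rw [← sum_prod_mul_single (h.sum_childLaw n i) g j0]
    exact sum_lik_succ d θ Δ n i fun B => g (B j0)
  have e : ∀ A : LConf d (n + 1),
      (π1 * lik d θ Δ (n + 1) 0 A + π2 * lik d θ Δ (n + 1) 1 A) *
        ((post d θ Δ (n + 1) 0 A - π1) - θ * (post d θ Δ n 0 (restrictChild j0 A) - π1)) ^ 2 =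
      (π1 * lik d θ Δ (n + 1) 0 A + π2 * lik d θ Δ (n + 1) 1 A) *
        (post d θ Δ (n + 1) 0 A - π1) ^ 2 -
      2 * θ * π1 * π2 *
        (lik d θ Δ (n + 1) 0 A * (post d θ Δ n 0 (restrictChild j0 A) - π1)) +
      2 * θ * π1 *
        (π2 * (lik d θ Δ (n + 1) 1 A * (post d θ Δ n 0 (restrictChild j0 A) - π1))) +
      θ ^ 2 * π1 * (lik d θ Δ (n + 1) 0 A * (post d θ Δ n 0 (restrictChild j0 A) - π1) ^ 2) +
      θ ^ 2 * π2 *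
        (lik d θ Δ (n + 1) 1 A * (post d θ Δ n 0 (restrictChild j0 A) - π1) ^ 2) := by
    intro A
    have hl := h.level_mul_post (n + 1) A
    rw [← hΔ] at hl
    generalize lik d θ Δ (n + 1) 0 A = u at *
    generalize lik d θ Δ (n + 1) 1 A = v at *
    generalize post d θ Δ (n + 1) 0 A = X at *
    generalize post d θ Δ n 0 (restrictChild j0 A) = y at *
    linear_combination (-2 * θ * (y - π1)) * hl +
      (2 * θ * (y - π1) * π1 * u) * h.sum_eq
  have hnn : 0 ≤ ∑ A : LConf d (n + 1),
      (π1 * lik d θ Δ (n + 1) 0 A + π2 * lik d θ Δ (n + 1) 1 A) *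
        ((post d θ Δ (n + 1) 0 A - π1) - θ * (post d θ Δ n 0 (restrictChild j0 A) - π1)) ^ 2 :=
    Finset.sum_nonneg fun A _ => mul_nonneg (h.level_pos _ A).le (sq_nonneg _)
  have hsq : π1 * ∑ B, childLaw d θ Δ n 0 B * (post d θ Δ n 0 B - π1) ^ 2 +
      π2 * ∑ B, childLaw d θ Δ n 1 B * (post d θ Δ n 0 B - π1) ^ 2 =
      π1 * xseq d θ Δ n := by
    rw [← h.sum_level_mul_sq, Finset.mul_sum, Finset.mul_sum, ← Finset.sum_add_distrib]
    refine Finset.sum_congr rfl fun B _ => ?_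
    rw [← h.stationary]
    ring
  rw [Finset.sum_congr rfl fun A _ => e A] at hnn
  simp only [Finset.sum_add_distrib, Finset.sum_sub_distrib, ← Finset.mul_sum] at hnn
  rw [h.sum_level_mul_sq, marg 0 fun B => post d θ Δ n 0 B - π1,
    marg 1 fun B => post d θ Δ n 0 B - π1, marg 0 fun B => (post d θ Δ n 0 B - π1) ^ 2,
    marg 1 fun B => (post d θ Δ n 0 B - π1) ^ 2, h.sum_childLaw_zero_mul,
    h.sum_childLaw_one_mul] at hnn
  refine le_of_mul_le_mul_left ?_ h.pos'
  have hs := h.sum_eq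
  rw [← hΔ] at hnn
  have key : π1 * xseq d θ Δ (n + 1) - 2 * θ * π1 * π2 * (θ * xseq d θ Δ n) +
      2 * θ * π1 * -(θ * π1 * xseq d θ Δ n) +
      θ ^ 2 * π1 * ∑ B, childLaw d θ Δ n 0 B * (post d θ Δ n 0 B - π1) ^ 2 +
      θ ^ 2 * π2 * ∑ B, childLaw d θ Δ n 1 B * (post d θ Δ n 0 B - π1) ^ 2 =
      π1 * xseq d θ Δ (n + 1) - π1 * (θ ^ 2 * xseq d θ Δ n) := by
    linear_combination θ ^ 2 * hsq - 2 * θ ^ 2 * π1 * xseq d θ Δ n * hs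
  linarith

lemma xseq_pos (h : Admissible π1 π2 d θ) (n : ℕ) : 0 < xseq d θ (Dlt θ π1 π2) n := by
  induction n with
  | zero => rw [h.xseq_zero]; exact h.pos
  | succ n ih =>
    exact (mul_pos (by have := h.ne_zero; positivity) ih).trans_le (h.theta_sq_mul_xseq_le n)

lemma xseq_le (h : Admissible π1 π2 d θ) (n : ℕ) :
    xseq d θ (Dlt θ π1 π2) n ≤ 2 * d * xseq d θ (Dlt θ π1 π2) (n + 1) := by
  have h1 := mul_le_mul_of_nonneg_left (h.theta_sq_mul_xseq_le n)
    (by positivity : (0 : ℝ) ≤ 2 * d)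
  have h2 := mul_le_mul_of_nonneg_right h.lower (h.xseq_pos n).le
  linarith

lemma prior_add_nonneg (h : Admissible π1 π2 d θ) (n : ℕ) (A : LConf d n) :
    0 ≤ π1 + θ * (post d θ (Dlt θ π1 π2) n 0 A - π1) := by
  obtain ⟨h1, -, h3, -⟩ := h.mmat_eq
  have e1 := h.entry_pos 0 0
  have e3 := h.entry_pos 1 0
  rw [h1] at e1
  rw [h3] at e3
  have a := mul_nonneg (h.post_nonneg n A) e1.le
  have b := mul_nonneg (sub_nonneg.2 (h.post_le_one n A)) e3.le
  have hs : π2 = 1 - π1 := by linarith [h.sum_eq]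
  generalize post d θ (Dlt θ π1 π2) n 0 A = y at *
  subst hs
  linarith

lemma prior_sub_nonneg (h : Admissible π1 π2 d θ) (n : ℕ) (A : LConf d n) :
    0 ≤ π2 - θ * (post d θ (Dlt θ π1 π2) n 0 A - π1) := by
  obtain ⟨-, h2, -, h4⟩ := h.mmat_eq
  have e2 := h.entry_pos 0 1
  have e4 := h.entry_pos 1 1
  rw [h2] at e2
  rw [h4] at e4
  have a := mul_nonneg (h.post_nonneg n A) e2.le
  have b := mul_nonneg (sub_nonneg.2 (h.post_le_one n A)) e4.le
  have hs : π2 = 1 - π1 := by linarith [h.sum_eq]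
  generalize post d θ (Dlt θ π1 π2) n 0 A = y at *
  subst hs
  linarith

end Admissible

namespace Admissible

variable {π1 π2 : ℝ} {d : ℕ} {θ : ℝ}

lemma childLaw_le (h : Admissible π1 π2 d θ) (n : ℕ) (i : Fin 2) (B : LConf d n) :
    childLaw d θ (Dlt θ π1 π2) n i B ≤
      lik d θ (Dlt θ π1 π2) n 0 B + lik d θ (Dlt θ π1 π2) n 1 B := by
  have hs := h.sum_mmat i
  rw [Fin.sum_univ_two] at hs
  rw [childLaw, Fin.sum_univ_two]
  exact add_le_add
    (mul_le_of_le_one_left (h.lik_nonneg n 0 B) (by linarith [h.entry_pos i 1]))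
    (mul_le_of_le_one_left (h.lik_nonneg n 1 B) (by linarith [h.entry_pos i 0]))

lemma sum_childLaw_mul_ind_le (h : Admissible π1 π2 d θ) (n : ℕ) (i : Fin 2) (ε : ℝ) :
    ∑ B, childLaw d θ (Dlt θ π1 π2) n i B * ind (ε < |post d θ (Dlt θ π1 π2) n 0 B - π1|) ≤
      dev π1 π2 d θ n ε :=
  Finset.sum_le_sum fun B _ => mul_le_mul_of_nonneg_right (h.childLaw_le n i B) (ind_nonneg _)

lemma sum_childLaw_mul_ind_nonneg (h : Admissible π1 π2 d θ) (n : ℕ) (i : Fin 2) (ε : ℝ) :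
    0 ≤ ∑ B, childLaw d θ (Dlt θ π1 π2) n i B *
      ind (ε < |post d θ (Dlt θ π1 π2) n 0 B - π1|) :=
  Finset.sum_nonneg fun B _ => mul_nonneg (h.childLaw_nonneg n i B) (ind_nonneg _)

lemma dev_le_two (h : Admissible π1 π2 d θ) (n : ℕ) (ε : ℝ) : dev π1 π2 d θ n ε ≤ 2 := by
  calc dev π1 π2 d θ n ε
      ≤ ∑ A, (lik d θ (Dlt θ π1 π2) n 0 A + lik d θ (Dlt θ π1 π2) n 1 A) :=
        Finset.sum_le_sum fun A _ => mul_le_of_le_one_right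
          (add_nonneg (h.lik_nonneg n 0 A) (h.lik_nonneg n 1 A)) (ind_le_one _)
    _ = 2 := by rw [Finset.sum_add_distrib, h.sum_lik, h.sum_lik]; norm_num

lemma abs_post_sub_le_one (h : Admissible π1 π2 d θ) (n : ℕ) (A : LConf d n) :
    |post d θ (Dlt θ π1 π2) n 0 A - π1| ≤ 1 := by
  have := h.post_nonneg n A
  have := h.post_le_one n A
  exact abs_le.2 ⟨by linarith [h.sum_eq, h.pos], by linarith [h.pos']⟩

lemma dev_eq_zero (h : Admissible π1 π2 d θ) (n : ℕ) {ε : ℝ} (hε : 1 ≤ ε) :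
    dev π1 π2 d θ n ε = 0 :=
  Finset.sum_eq_zero fun A _ => by
    rw [ind_of_not (not_lt.2 ((h.abs_post_sub_le_one n A).trans hε)), mul_zero]

/-- Chebyshev's inequality for the posterior. -/
lemma dev_le_mul_xseq (h : Admissible π1 π2 d θ) (n : ℕ) {ε : ℝ} (hε : 0 < ε) :
    dev π1 π2 d θ n ε ≤ π1 / (π2 * ε ^ 2) * xseq d θ (Dlt θ π1 π2) n := by
  have hp := h.pos
  have key : π2 * ε ^ 2 * dev π1 π2 d θ n ε ≤ π1 * xseq d θ (Dlt θ π1 π2) n := by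
    rw [← h.sum_level_mul_sq, dev, Finset.mul_sum]
    refine Finset.sum_le_sum fun A _ => ?_
    have h0 := h.lik_nonneg n 0 A
    have h1 := h.lik_nonneg n 1 A
    have hi : ε ^ 2 * ind (ε < |post d θ (Dlt θ π1 π2) n 0 A - π1|) ≤
        (post d θ (Dlt θ π1 π2) n 0 A - π1) ^ 2 := by
      by_cases hb : ε < |post d θ (Dlt θ π1 π2) n 0 A - π1|
      · rw [ind_of hb, mul_one, ← sq_abs (_ - π1)]
        exact pow_le_pow_left₀ hε.le hb.le 2
      · rw [ind_of_not hb, mul_zero]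
        exact sq_nonneg _
    have hw : π2 * (lik d θ (Dlt θ π1 π2) n 0 A + lik d θ (Dlt θ π1 π2) n 1 A) ≤
        π1 * lik d θ (Dlt θ π1 π2) n 0 A + π2 * lik d θ (Dlt θ π1 π2) n 1 A := by
      linarith [mul_le_mul_of_nonneg_right h.le h0]
    calc _ = π2 * (lik d θ (Dlt θ π1 π2) n 0 A + lik d θ (Dlt θ π1 π2) n 1 A) *
          (ε ^ 2 * ind (ε < |post d θ (Dlt θ π1 π2) n 0 A - π1|)) := by ring
      _ ≤ _ := mul_le_mul hw hi (mul_nonneg (by positivity) (ind_nonneg _)) (h.level_pos n A).le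
  rw [div_mul_eq_mul_div, le_div_iff₀ (by positivity)]
  linarith

/-- The posterior at the root can only deviate from the prior if some child deviates even
more, or if two children deviate by a fixed amount. -/
lemma sum_prod_childLaw_le (h : Admissible π1 π2 d θ) {D ε δ : ℝ} (hD : (d : ℝ) ≤ D)
    (hε0 : 0 < ε) (hε1 : ε < 1) (hδ0 : 0 ≤ δ)
    (hδ : D * (π2⁻¹ * δ) ≤ Real.log (1 + ε / 40)) (n : ℕ) (i : Fin 2) :
    ∑ B : Fin d → LConf d n, (∏ j, childLaw d θ (Dlt θ π1 π2) n i (B j)) *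
        ind (ε < |combine π1 π2 θ (fun j => post d θ (Dlt θ π1 π2) n 0 (B j)) - π1|) ≤
      d * dev π1 π2 d θ n (6 / 5 * ε) + d ^ 2 * dev π1 π2 d θ n δ ^ 2 := by
  refine (sum_prod_mul_ind_le (h.childLaw_nonneg n i) (h.sum_childLaw n i)
    (fun A => 6 / 5 * ε < |post d θ (Dlt θ π1 π2) n 0 A - π1|)
    (fun A => δ < |post d θ (Dlt θ π1 π2) n 0 A - π1|) _ fun B hB => ?_).trans ?_
  · by_contra! hcon
    obtain ⟨hE, hF⟩ := hcon
    refine not_le.2 hB ?_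
    have main : ∀ k : Fin d,
        (∀ j, j ≠ k → |post d θ (Dlt θ π1 π2) n 0 (B j) - π1| ≤ δ) →
        |combine π1 π2 θ (fun j => post d θ (Dlt θ π1 π2) n 0 (B j)) - π1| ≤ ε := fun k hk =>
      abs_combine_sub_le h.sum_eq h.le h.pos h.theta_sq_le hε0 hε1 hD hδ0 hδ k
        (h.prior_add_nonneg n (B k)) (h.prior_sub_nonneg n (B k)) (hE k) hk
    by_cases hk : ∃ k, δ < |post d θ (Dlt θ π1 π2) n 0 (B k) - π1|
    · obtain ⟨k, hk⟩ := hk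
      exact main k fun j hj => hF k j hj.symm hk
    · push Not at hk
      exact main ⟨0, by linarith [h.two_le]⟩ fun j _ => hk j
  · have := h.sum_childLaw_mul_ind_nonneg n i δ
    gcongr
    · exact h.sum_childLaw_mul_ind_le n i _
    · exact h.sum_childLaw_mul_ind_le n i _

lemma dev_succ_le (h : Admissible π1 π2 d θ) {D ε δ : ℝ} (hD : (d : ℝ) ≤ D)
    (hε0 : 0 < ε) (hε1 : ε < 1) (hδ0 : 0 ≤ δ)
    (hδ : D * (π2⁻¹ * δ) ≤ Real.log (1 + ε / 40)) (n : ℕ) :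
    dev π1 π2 d θ (n + 1) ε ≤
      2 * (d * dev π1 π2 d θ n (6 / 5 * ε) + d ^ 2 * dev π1 π2 d θ n δ ^ 2) := by
  have e : ∀ i, ∑ A : LConf d (n + 1), lik d θ (Dlt θ π1 π2) (n + 1) i A *
      ind (ε < |post d θ (Dlt θ π1 π2) (n + 1) 0 A - π1|) ≤
      d * dev π1 π2 d θ n (6 / 5 * ε) + d ^ 2 * dev π1 π2 d θ n δ ^ 2 := by
    intro i
    simp only [h.post_succ]
    rw [sum_lik_succ d θ (Dlt θ π1 π2) n i fun B =>
      ind (ε < |combine π1 π2 θ (fun j => post d θ (Dlt θ π1 π2) n 0 (B j)) - π1|)]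
    exact h.sum_prod_childLaw_le hD hε0 hε1 hδ0 hδ n i
  simp only [dev, add_mul, Finset.sum_add_distrib] at e ⊢
  linarith [e 0, e 1]

lemma dev_nonneg (h : Admissible π1 π2 d θ) (n : ℕ) (ε : ℝ) : 0 ≤ dev π1 π2 d θ n ε :=
  (h.sum_childLaw_mul_ind_nonneg n 0 ε).trans (h.sum_childLaw_mul_ind_le n 0 ε)

lemma probBad_eq (h : Admissible π1 π2 d θ) (n : ℕ) (ε : ℝ) :
    probBad d θ (Dlt θ π1 π2) n ε =
      ∑ B : Fin d → LConf d n, (∏ j, childLaw d θ (Dlt θ π1 π2) n 0 (B j)) *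
        ind (ε < |combine π1 π2 θ (fun j => post d θ (Dlt θ π1 π2) n 0 (B j)) - π1|) := by
  rw [← sum_lik_succ d θ (Dlt θ π1 π2) n 0 fun B =>
      ind (ε < |combine π1 π2 θ (fun j => post d θ (Dlt θ π1 π2) n 0 (B j)) - π1|), probBad]
  refine Finset.sum_congr rfl fun A _ => ?_
  simp only [Z1fun, Z2fun, Yfun, h.pst_zero, h.pst_one, h.condLevel_zero]
  change (if ε < |combine π1 π2 θ (fun j => post d θ (Dlt θ π1 π2) n 0 (restrictChild j A)) - π1|
    then _ else _) = _
  split_ifs with hb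
  · rw [ind_of hb, mul_one]
  · rw [ind_of_not hb, mul_zero]

end Admissible

/-- The probability of an `ε`-deviation of the posterior is of order `x_n ^ k`, uniformly
over all admissible trees of degree at most `D`. -/
def DevBound (π1 π2 D : ℝ) (ε : ℝ) (k : ℕ) : Prop :=
  ∃ C : ℝ, 0 ≤ C ∧ ∀ (d : ℕ) (θ : ℝ), Admissible π1 π2 d θ → (d : ℝ) ≤ D → ∀ n,
    dev π1 π2 d θ n ε ≤ C * xseq d θ (Dlt θ π1 π2) n ^ k

lemma devBound_one {π1 π2 : ℝ} (h1 : 0 < π1) (h2 : 0 < π2) (D : ℝ) {ε : ℝ} (hε : 0 < ε) :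
    DevBound π1 π2 D ε 1 :=
  ⟨π1 / (π2 * ε ^ 2), by positivity, fun d θ h _ n => by
    rw [pow_one]; exact h.dev_le_mul_xseq n hε⟩

lemma devBound_of_one_le (π1 π2 D : ℝ) {ε : ℝ} (hε : 1 ≤ ε) (k : ℕ) :
    DevBound π1 π2 D ε k :=
  ⟨0, le_rfl, fun d θ h _ n => by rw [h.dev_eq_zero n hε, zero_mul]⟩

lemma DevBound.step {π1 π2 D ε δ : ℝ} {k : ℕ} (h2 : 0 < π2) (hD : 0 < D) (hε0 : 0 < ε)
    (hε1 : ε < 1) (hδ0 : 0 ≤ δ) (hδ : D * (π2⁻¹ * δ) ≤ Real.log (1 + ε / 40))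
    (hb : DevBound π1 π2 D δ k) (hb2 : DevBound π1 π2 D (6 / 5 * ε) (2 * k)) :
    DevBound π1 π2 D ε (2 * k) := by
  obtain ⟨C1, hC1, H1⟩ := hb
  obtain ⟨C2, hC2, H2⟩ := hb2
  refine ⟨2 * (D * C2 + D ^ 2 * C1 ^ 2) * (2 * D) ^ (2 * k) + 2 / π2 ^ (2 * k),
    by positivity, fun d θ h hd n => ?_⟩
  rcases n with _ | n
  · rw [h.xseq_zero]
    refine (h.dev_le_two 0 ε).trans ?_
    rw [add_mul, div_mul_cancel₀ _ (by positivity)]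
    exact le_add_of_nonneg_left (by positivity)
  · have hx := h.xseq_pos n
    have hx' := h.xseq_pos (n + 1)
    have hxle : xseq d θ (Dlt θ π1 π2) n ≤ 2 * D * xseq d θ (Dlt θ π1 π2) (n + 1) :=
      (h.xseq_le n).trans (by gcongr)
    have hsucc := h.dev_succ_le hd hε0 hε1 hδ0 hδ n
    have b1 := H1 d θ h hd n
    have b2 := H2 d θ h hd n
    have n1 := h.dev_nonneg n δ
    have n2 := h.dev_nonneg n (6 / 5 * ε)
    generalize xseq d θ (Dlt θ π1 π2) n = x at *
    generalize xseq d θ (Dlt θ π1 π2) (n + 1) = x' at *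
    calc dev π1 π2 d θ (n + 1) ε
        ≤ 2 * (d * dev π1 π2 d θ n (6 / 5 * ε) + d ^ 2 * dev π1 π2 d θ n δ ^ 2) := hsucc
      _ ≤ 2 * (D * (C2 * x ^ (2 * k)) + D ^ 2 * (C1 * x ^ k) ^ 2) := by gcongr
      _ = 2 * (D * C2 + D ^ 2 * C1 ^ 2) * x ^ (2 * k) := by ring
      _ ≤ 2 * (D * C2 + D ^ 2 * C1 ^ 2) * (2 * D * x') ^ (2 * k) := by gcongr
      _ = 2 * (D * C2 + D ^ 2 * C1 ^ 2) * (2 * D) ^ (2 * k) * x' ^ (2 * k) := by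
        rw [mul_pow]; ring
      _ ≤ _ := by
        gcongr
        exact le_add_of_nonneg_right (by positivity)

lemma log_one_add_pos {ε : ℝ} (hε : 0 < ε) : 0 < Real.log (1 + ε / 40) :=
  Real.log_pos (by linarith)

lemma devBound_double {π1 π2 D : ℝ} {k : ℕ} (h2 : 0 < π2) (hD : 0 < D)
    (hb : ∀ ε, 0 < ε → DevBound π1 π2 D ε k) (ε : ℝ) (hε : 0 < ε) :
    DevBound π1 π2 D ε (2 * k) := by
  obtain ⟨m, hm⟩ := pow_unbounded_of_one_lt (1 / ε) (by norm_num : (1 : ℝ) < 6 / 5)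
  rw [div_lt_iff₀ hε] at hm
  induction m generalizing ε with
  | zero => exact devBound_of_one_le _ _ _ (by simpa using hm.le) _
  | succ m ih =>
    rcases le_or_gt 1 ε with h1 | h1
    · exact devBound_of_one_le _ _ _ h1 _
    · have hl := log_one_add_pos hε
      refine DevBound.step (δ := π2 * Real.log (1 + ε / 40) / D) h2 hD hε h1 (by positivity)
        (le_of_eq ?_) (hb _ (by positivity)) (ih (6 / 5 * ε) (by positivity) ?_)
      · field_simp
      · rw [pow_succ] at hm; linarith

lemma devBound_two_pow {π1 π2 D : ℝ} (h1 : 0 < π1) (h2 : 0 < π2) (hD : 0 < D) (m : ℕ) :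
    ∀ ε, 0 < ε → DevBound π1 π2 D ε (2 ^ m) := by
  induction m with
  | zero => exact fun ε hε => devBound_one h1 h2 D hε
  | succ m ih =>
    intro ε hε
    rw [pow_succ']
    exact devBound_double h2 hD ih ε hε

/-- Concentration uniformly over trees of bounded degree. -/
lemma exists_probBad_le_of_degree_le {π1 π2 D ε α : ℝ} (h1 : 0 < π1) (h2 : 0 < π2)
    (hD : 0 < D) (hε0 : 0 < ε) (hε1 : ε < 1) :
    ∃ C : ℝ, 0 ≤ C ∧ ∀ (d : ℕ) (θ : ℝ), Admissible π1 π2 d θ → (d : ℝ) ≤ D → ∀ n,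
      probBad d θ (Dlt θ π1 π2) n ε ≤ C * xseq d θ (Dlt θ π1 π2) n ^ α := by
  obtain ⟨m, hm⟩ := pow_unbounded_of_one_lt α (one_lt_two : (1 : ℝ) < 2)
  have hl := log_one_add_pos hε0
  set δ := π2 * Real.log (1 + ε / 40) / D with hδ
  have hδ0 : 0 < δ := by positivity
  obtain ⟨C1, hC1, H1⟩ := devBound_two_pow h1 h2 hD m δ hδ0
  obtain ⟨C2, hC2, H2⟩ := devBound_two_pow h1 h2 hD m (6 / 5 * ε) (by positivity)
  refine ⟨D * C2 + D ^ 2 * C1 ^ 2, by positivity, fun d θ h hd n => ?_⟩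
  have hx := h.xseq_pos n
  have hx1 := h.xseq_le_one n
  have b1 := H1 d θ h hd n
  have b2 := H2 d θ h hd n
  have n1 := h.dev_nonneg n δ
  have n2 := h.dev_nonneg n (6 / 5 * ε)
  have hstep := h.sum_prod_childLaw_le hd hε0 hε1 hδ0.le (by rw [hδ]; field_simp; rfl) n 0
  rw [h.probBad_eq]
  generalize xseq d θ (Dlt θ π1 π2) n = x at *
  have hpow : x ^ 2 ^ m ≤ x ^ α := by
    rw [← Real.rpow_natCast]
    exact Real.rpow_le_rpow_of_exponent_ge hx hx1 (by push_cast; exact hm.le)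
  have hsq : (x ^ 2 ^ m) ^ 2 ≤ x ^ 2 ^ m := by
    rw [sq]
    exact mul_le_of_le_one_left (by positivity) (pow_le_one₀ hx.le hx1)
  calc _ ≤ d * dev π1 π2 d θ n (6 / 5 * ε) + d ^ 2 * dev π1 π2 d θ n δ ^ 2 := hstep
    _ ≤ D * (C2 * x ^ 2 ^ m) + D ^ 2 * (C1 * x ^ 2 ^ m) ^ 2 := by gcongr
    _ = D * C2 * x ^ 2 ^ m + D ^ 2 * C1 ^ 2 * (x ^ 2 ^ m) ^ 2 := by ring
    _ ≤ D * C2 * x ^ α + D ^ 2 * C1 ^ 2 * x ^ α := by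
      gcongr
      exact hsq.trans hpow
    _ = _ := by ring

/-- Assuming `1/2 ≤ dθ² ≤ 1`, for any `0 < ε < 1` and `α > 1` there
exist `C = C(π, ε, α)` and `N₁ = N₁(π, ε, α)` such that for all `n ≥ N₁`,
`P(|π₁Z₁/(π₁Z₁ + π₂Z₂) − π₁| > ε) ≤ C·x_n^α`. -/
theorem concentration_ratio (π1 π2 : ℝ) (hsum : π1 + π2 = 1) (hord : π2 ≤ π1)
    (hpi2 : 0 < π2) :
    ∀ ε : ℝ, 0 < ε → ε < 1 → ∀ α : ℝ, 1 < α →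
      ∃ C : ℝ, ∃ N1 : ℕ, ∀ d : ℕ, 2 ≤ d → ∀ θ : ℝ, θ ≠ 0 →
        (∀ i j, 0 < Mmat θ (Dlt θ π1 π2) i j) →
        1 / 2 ≤ (d : ℝ) * θ ^ 2 → (d : ℝ) * θ ^ 2 ≤ 1 →
        ∀ n : ℕ, N1 ≤ n →
          probBad d θ (Dlt θ π1 π2) n ε ≤ C * xseq d θ (Dlt θ π1 π2) n ^ α := by
  intro ε hε0 hε1 α hα
  have h1 : 0 < π1 := hpi2.trans_le hord
  have hα0 : 0 < α := by linarith
  have hl : 0 < Real.log (1 + ε) := Real.log_pos (by linarith)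
  obtain ⟨δ, hδ0, hδ1, hδ2⟩ : ∃ δ : ℝ, 0 < δ ∧ π2⁻¹ * δ ≤ 1 / 2 ∧
      6 * π2⁻¹ ^ 2 * δ * α / Real.log (1 + ε) ≤ 1 / 2 := by
    refine ⟨min (π2 / 2) (Real.log (1 + ε) / (12 * π2⁻¹ ^ 2 * α)),
      lt_min (by positivity) (by positivity), ?_, ?_⟩
    · calc _ ≤ π2⁻¹ * (π2 / 2) := by gcongr; exact min_le_left _ _
        _ = 1 / 2 := by field_simp
    · calc _ ≤ 6 * π2⁻¹ ^ 2 * (Real.log (1 + ε) / (12 * π2⁻¹ ^ 2 * α)) * α /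
            Real.log (1 + ε) := by gcongr; exact min_le_right _ _
        _ = 1 / 2 := by field_simp; norm_num
  obtain ⟨C1, hC1, H1⟩ := exists_probBad_le_of_degree_le (D := 1 / δ ^ 2) (α := α) h1 hpi2
    (by positivity) hε0 hε1
  set C2 := 2 * Real.exp (36 * π2⁻¹ ^ 4 *
    (2 * (α / Real.log (1 + ε)) + 8 * (α / Real.log (1 + ε)) ^ 2)) with hC2
  refine ⟨C1 + C2, 0, fun d hd θ hθ hM hlo hup n _ => ?_⟩
  have h : Admissible π1 π2 d θ := ⟨hsum, hord, hpi2, hd, hθ, hM, hlo, hup⟩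
  have hx := h.xseq_pos n
  rcases le_or_gt |θ| δ with hs | hs
  · rw [h.probBad_eq]
    refine (combine_concentration_of_small hsum hord hpi2 (h.childLaw_nonneg n 0)
      (h.sum_childLaw n 0) (h.post_nonneg n) (h.post_le_one n) hx (h.xseq_le_one n) hup
      (h.sum_childLaw_zero_mul n) (h.sum_childLaw_zero_mul_sq_le n) hε0 hα0
      (le_trans (by gcongr) hδ1) (le_trans (by gcongr) hδ2)).trans ?_
    rw [← hC2]
    gcongr
    exact le_add_of_nonneg_left hC1
  · refine (H1 d θ h ?_ n).trans ?_
    · rw [le_div_iff₀ (by positivity)]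
      refine (mul_le_mul_of_nonneg_left ?_ d.cast_nonneg).trans hup
      exact sq_le_sq.2 (by rw [abs_of_pos hδ0]; exact hs.le)
    · gcongr
      exact le_add_of_nonneg_right (by positivity)

end AsymIsing
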